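/- (Corollary, Blackwell with noiseless feedback) For every p ∈ (0,1/2), noiseless feedback enlarges the capacity region of the noisy Blackwell DMBC: C_NoFB is a proper subset of C_NoiselessFB. In particular, the noiseless-feedback sum-capacity sup{R₁+R₂ : (0,R₁,R₂) ∈ C_NoiselessFB} strictly exceeds the no-feedback sum-capacity sup{R₁+R₂ : (0,R₁,R₂) ∈ C_NoFB}. -/

import Mathlib

open scoped BigOperators Classical

noncomputable section

namespace BCFB

variable {Ω A B C : Type*}

/-- Probability of an event under a weight function on a finite sample space. -/
def prOf [Fintype Ω] (w : Ω → ℝ) (E : Ω → Prop) : ℝ :=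
  ∑ ω, if E ω then w ω else 0

/-- Distribution (pushforward) of a random variable. -/
def distOf [Fintype Ω] (w : Ω → ℝ) (X : Ω → A) : A → ℝ :=
  fun a => prOf w fun ω => X ω = a

/-- Shannon entropy (base 2) of a random variable. -/
def entOf [Fintype Ω] [Fintype A] (w : Ω → ℝ) (X : Ω → A) : ℝ :=
  -∑ a, distOf w X a * Real.logb 2 (distOf w X a)

/-- Mutual information (base 2). -/
def miOf [Fintype Ω] [Fintype A] [Fintype B] (w : Ω → ℝ) (X : Ω → A) (Y : Ω → B) : ℝ :=
  entOf w X + entOf w Y - entOf w fun ω => (X ω, Y ω)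

/-- Conditional mutual information I(X;Y|Z) (base 2). -/
def cmiOf [Fintype Ω] [Fintype A] [Fintype B] [Fintype C]
    (w : Ω → ℝ) (X : Ω → A) (Y : Ω → B) (Z : Ω → C) : ℝ :=
  entOf w (fun ω => (X ω, Z ω)) + entOf w (fun ω => (Y ω, Z ω))
    - entOf w (fun ω => (X ω, Y ω, Z ω)) - entOf w Z

/-- `w` is a probability mass function. -/
def IsPMF [Fintype Ω] (w : Ω → ℝ) : Prop := (∀ ω, 0 ≤ w ω) ∧ ∑ ω, w ω = 1

/-- `k` is a transition kernel (each row a pmf). -/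
def IsKernel {A B : Type*} [Fintype A] [Fintype B] (k : A → B → ℝ) : Prop :=
  ∀ a, IsPMF (k a)

/-- `X — Y — Z` forms a Markov chain (i.e. `X` and `Z` are conditionally
independent given `Y`). -/
def MarkovChain [Fintype Ω] (w : Ω → ℝ) (X : Ω → A) (Y : Ω → B) (Z : Ω → C) : Prop :=
  ∀ a b c,
    distOf w (fun ω => (X ω, Y ω, Z ω)) (a, b, c) * distOf w Y b
      = distOf w (fun ω => (X ω, Y ω)) (a, b) * distOf w (fun ω => (Z ω, Y ω)) (c, b)

/-- `X` and `Y` are independent. -/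
def IndepRV [Fintype Ω] (w : Ω → ℝ) (X : Ω → A) (Y : Ω → B) : Prop :=
  ∀ a b, distOf w (fun ω => (X ω, Y ω)) (a, b) = distOf w X a * distOf w Y b

/-- Number of messages of rate `R` and blocklength `n`: `⌊2^{nR}⌋`. -/
def msgCard (n : ℕ) (R : ℝ) : ℕ := ⌊(2 : ℝ) ^ ((n : ℝ) * R)⌋₊

/-- Binary entropy function. -/
def hb (u : ℝ) : ℝ := -(u * Real.logb 2 u) - (1 - u) * Real.logb 2 (1 - u)

/-- Empirical frequency of the letter `a` in the sequence `x`. -/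
def freqOf {A : Type*} {n : ℕ} (x : Fin n → A) (a : A) : ℝ :=
  ((Finset.univ.filter fun t => x t = a).card : ℝ) / n

/-- `ε`-typicality of a sequence w.r.t. a pmf `P`. -/
def Typical {A : Type*} (ε : ℝ) {n : ℕ} (P : A → ℝ) (x : Fin n → A) : Prop :=
  ∀ a, |freqOf x a - P a| ≤ ε * P a

section NoFB

variable {X Y1 Y2 : Type*} [Fintype X] [Fintype Y1] [Fintype Y2]

/-- Error probability of a blocklength-`n` no-feedback code over the DMBC `W`. -/
def errProbNoFB (W : X → Y1 × Y2 → ℝ) (n : ℕ) (R0 R1 R2 : ℝ)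
    (enc : Fin (msgCard n R0) × Fin (msgCard n R1) × Fin (msgCard n R2) → Fin n → X)
    (dec1 : (Fin n → Y1) → Fin (msgCard n R0) × Fin (msgCard n R1))
    (dec2 : (Fin n → Y2) → Fin (msgCard n R0) × Fin (msgCard n R2)) : ℝ :=
  (1 / ((msgCard n R0 : ℝ) * (msgCard n R1 : ℝ) * (msgCard n R2 : ℝ))) *
    ∑ m : Fin (msgCard n R0) × Fin (msgCard n R1) × Fin (msgCard n R2),
      ∑ y : Fin n → Y1 × Y2,
        (∏ t, W (enc m t) (y t)) *
          (if dec1 (fun t => (y t).1) ≠ (m.1, m.2.1) ∨ dec2 (fun t => (y t).2) ≠ (m.1, m.2.2)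
            then 1 else 0)

/-- Achievability of a rate triple over the DMBC `W` without feedback. -/
def AchievableNoFB (W : X → Y1 × Y2 → ℝ) (R0 R1 R2 : ℝ) : Prop :=
  0 ≤ R0 ∧ 0 ≤ R1 ∧ 0 ≤ R2 ∧
    ∃ enc : (n : ℕ) →
        Fin (msgCard n R0) × Fin (msgCard n R1) × Fin (msgCard n R2) → Fin n → X,
    ∃ dec1 : (n : ℕ) → (Fin n → Y1) → Fin (msgCard n R0) × Fin (msgCard n R1),
    ∃ dec2 : (n : ℕ) → (Fin n → Y2) → Fin (msgCard n R0) × Fin (msgCard n R2),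
      Filter.Tendsto (fun n => errProbNoFB W n R0 R1 R2 (enc n) (dec1 n) (dec2 n))
        Filter.atTop (nhds 0)

/-- The no-feedback capacity region. -/
def CNoFB (W : X → Y1 × Y2 → ℝ) : Set (ℝ × ℝ × ℝ) :=
  closure {r | AchievableNoFB W r.1 r.2.1 r.2.2}

end NoFB

section FB

variable {X Y1 Y2 Yt : Type*} [Fintype X] [Fintype Y1] [Fintype Y2] [Fintype Yt]

/-- Causality: the time-`t` channel input depends only on feedback symbols before time `t`. -/
def Causal {X Yt : Type*} (n : ℕ) {M : Type*} (enc : Fin n → M → (Fin n → Yt) → X) : Prop :=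
  ∀ (t : Fin n) (m : M) (fb fb' : Fin n → Yt),
    (∀ s : Fin n, (s : ℕ) < (t : ℕ) → fb s = fb' s) → enc t m fb = enc t m fb'

/-- Error probability of a blocklength-`n` feedback code over the DMBC with
generalized feedback `W`. -/
def errProbFB (W : X → Y1 × Y2 × Yt → ℝ) (n : ℕ) (R0 R1 R2 : ℝ)
    (enc : Fin n → Fin (msgCard n R0) × Fin (msgCard n R1) × Fin (msgCard n R2) →
      (Fin n → Yt) → X)
    (dec1 : (Fin n → Y1) → Fin (msgCard n R0) × Fin (msgCard n R1))
    (dec2 : (Fin n → Y2) → Fin (msgCard n R0) × Fin (msgCard n R2)) : ℝ :=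
  (1 / ((msgCard n R0 : ℝ) * (msgCard n R1 : ℝ) * (msgCard n R2 : ℝ))) *
    ∑ m : Fin (msgCard n R0) × Fin (msgCard n R1) × Fin (msgCard n R2),
      ∑ y : Fin n → Y1 × Y2 × Yt,
        (∏ t, W (enc t m fun s => (y s).2.2) (y t)) *
          (if dec1 (fun t => (y t).1) ≠ (m.1, m.2.1) ∨
              dec2 (fun t => (y t).2.1) ≠ (m.1, m.2.2)
            then 1 else 0)

/-- Achievability of a rate triple over the DMBC with generalized feedback `W`. -/
def AchievableFB (W : X → Y1 × Y2 × Yt → ℝ) (R0 R1 R2 : ℝ) : Prop :=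
  0 ≤ R0 ∧ 0 ≤ R1 ∧ 0 ≤ R2 ∧
    ∃ enc : (n : ℕ) → Fin n →
        Fin (msgCard n R0) × Fin (msgCard n R1) × Fin (msgCard n R2) → (Fin n → Yt) → X,
    ∃ dec1 : (n : ℕ) → (Fin n → Y1) → Fin (msgCard n R0) × Fin (msgCard n R1),
    ∃ dec2 : (n : ℕ) → (Fin n → Y2) → Fin (msgCard n R0) × Fin (msgCard n R2),
      (∀ n, Causal n (enc n)) ∧
      Filter.Tendsto (fun n => errProbFB W n R0 R1 R2 (enc n) (dec1 n) (dec2 n))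
        Filter.atTop (nhds 0)

/-- Capacity region of the DMBC with generalized feedback `W`. -/
def CGenFB (W : X → Y1 × Y2 × Yt → ℝ) : Set (ℝ × ℝ × ℝ) :=
  closure {r | AchievableFB W r.1 r.2.1 r.2.2}

end FB

/-- Extension of a DMBC to a generalized-feedback channel with noiseless feedback
`Ỹ = (Y₁, Y₂)`. -/
def noiselessExt {X Y1 Y2 : Type*} (W : X → Y1 × Y2 → ℝ) :
    X → Y1 × Y2 × (Y1 × Y2) → ℝ :=
  fun x y => if y.2.2 = (y.1, y.2.1) then W x (y.1, y.2.1) else 0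

/-- Capacity region of a DMBC with noiseless feedback. -/
def CNoiselessFB {X Y1 Y2 : Type*} [Fintype X] [Fintype Y1] [Fintype Y2]
    (W : X → Y1 × Y2 → ℝ) : Set (ℝ × ℝ × ℝ) :=
  CGenFB (noiselessExt W)

section Marton

variable {X Y1 Y2 : Type*} [Fintype X] [Fintype Y1] [Fintype Y2]

/-- The single-letter Marton constraints for the rate triple `(R0,R1,R2)`. -/
def MartonCond (W : X → Y1 × Y2 → ℝ) (R0 R1 R2 : ℝ) : Prop :=
  ∃ (k0 k1 k2 : ℕ) (p : Fin k0 × Fin k1 × Fin k2 → ℝ)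
    (f : Fin k0 × Fin k1 × Fin k2 → X), IsPMF p ∧
    (let w : (Fin k0 × Fin k1 × Fin k2) × Y1 × Y2 → ℝ := fun z => p z.1 * W (f z.1) z.2
     let U0 := fun z : (Fin k0 × Fin k1 × Fin k2) × Y1 × Y2 => z.1.1
     let U1 := fun z : (Fin k0 × Fin k1 × Fin k2) × Y1 × Y2 => z.1.2.1
     let U2 := fun z : (Fin k0 × Fin k1 × Fin k2) × Y1 × Y2 => z.1.2.2
     let Yr1 := fun z : (Fin k0 × Fin k1 × Fin k2) × Y1 × Y2 => z.2.1
     let Yr2 := fun z : (Fin k0 × Fin k1 × Fin k2) × Y1 × Y2 => z.2.2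
     R0 < min (miOf w U0 Yr1) (miOf w U0 Yr2) ∧
     R0 + R1 < miOf w (fun z => (U0 z, U1 z)) Yr1 ∧
     R0 + R2 < miOf w (fun z => (U0 z, U2 z)) Yr2 ∧
     R0 + R1 + R2 < cmiOf w U1 Yr1 U0 + cmiOf w U2 Yr2 U0
       + min (miOf w U0 Yr1) (miOf w U0 Yr2) - cmiOf w U1 U2 U0)

/-- Marton's achievable region for the DMBC `W` without feedback. -/
def MartonRegion (W : X → Y1 × Y2 → ℝ) : Set (ℝ × ℝ × ℝ) :=
  closure {r | 0 ≤ r.1 ∧ 0 ≤ r.2.1 ∧ 0 ≤ r.2.2 ∧ MartonCond W r.1 r.2.1 r.2.2}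

end Marton

end BCFB
namespace BCFB

/-- The noisy Blackwell DMBC with noise parameter `p`: with `Z ~ Bern(p)`,
`Y₁ = Z ⊕ 1{X ≥ 1}` and `Y₂ = Z ⊕ 1{X = 2}`. -/
def blackwellW (p : ℝ) : Fin 3 → Bool × Bool → ℝ :=
  fun x y => ∑ z : Bool,
    (if z then p else 1 - p) *
      (if y = (Bool.xor (decide (1 ≤ (x : ℕ))) z, Bool.xor (decide ((x : ℕ) = 2)) z)
        then 1 else 0)

/-- The noisy Blackwell DMBC with noisy feedback `Ỹ = (Y₁⊕W₁, Y₂⊕W₂)`, where the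
feedback-noise pair `(W₁,W₂)` has law `Q`. -/
def blackwellNoisyW (p : ℝ) (Q : Bool × Bool → ℝ) :
    Fin 3 → Bool × Bool × (Bool × Bool) → ℝ :=
  fun x y =>
    blackwellW p x (y.1, y.2.1) * Q (Bool.xor y.2.2.1 y.1, Bool.xor y.2.2.2 y.2.1)

end BCFB
namespace BCFB

/-- Crossover probability of a `Bern(q)` bit sent through a binary symmetric channel. -/
def bconv (p q : ℝ) : ℝ := p + (1 - 2 * p) * q

lemma hasSum_log_two_sub_binEntropy {x : ℝ} (hx : |x| < 1) :
    HasSum (fun k : ℕ => 1 / ((2 * (k : ℝ) + 1) * (2 * k + 2)) * (x ^ 2) ^ (k + 1))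
      (Real.log 2 - Real.binEntropy ((1 - x) / 2)) := by
  have h1 := (Real.hasSum_log_sub_log_of_abs_lt_one hx).mul_left (x / 2)
  have hx2 : |x ^ 2| < 1 := by
    rw [abs_pow]
    exact pow_lt_one₀ (abs_nonneg _) hx two_ne_zero
  have h2 := (Real.hasSum_pow_div_log_of_abs_lt_one hx2).mul_left (1 / 2)
  obtain ⟨hl, hr⟩ := abs_lt.1 hx
  have h3 := h1.sub h2
  have hf : (fun k : ℕ => 1 / ((2 * (k : ℝ) + 1) * (2 * k + 2)) * (x ^ 2) ^ (k + 1)) =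
      fun k : ℕ => x / 2 * (2 * (1 / (2 * (k : ℝ) + 1)) * x ^ (2 * k + 1))
        - 1 / 2 * ((x ^ 2) ^ (k + 1) / ((k : ℝ) + 1)) := by
    funext k
    have e1 : (2 * (k : ℝ) + 1) ≠ 0 := by positivity
    have e2 : ((k : ℝ) + 1) ≠ 0 := by positivity
    rw [← pow_mul, show 2 * (k + 1) = 2 * k + 1 + 1 by ring]
    field_simp
    ring
  have hs : Real.log 2 - Real.binEntropy ((1 - x) / 2) =
      x / 2 * (Real.log (1 + x) - Real.log (1 - x)) - 1 / 2 * -Real.log (1 - x ^ 2) := by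
    have n1 : (1 + x) ≠ 0 := by linarith
    have n2 : (1 - x) ≠ 0 := by linarith
    have e1 : Real.log (1 - x ^ 2) = Real.log (1 + x) + Real.log (1 - x) := by
      rw [← Real.log_mul n1 n2]; congr 1; ring
    rw [e1, Real.binEntropy, show 1 - (1 - x) / 2 = (1 + x) / 2 by ring, Real.log_inv,
      Real.log_inv, Real.log_div n1 two_ne_zero, Real.log_div n2 two_ne_zero]
    ring
  rw [hf, hs]
  exact h3

lemma mul_lt_mul_of_hasSum_pow {c : ℕ → ℝ} (hc : ∀ k, 0 < c k) {L a b A B D : ℝ}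
    (hL : ∀ n, ∑ k ∈ Finset.range n, c k ≤ L) (ha0 : 0 < a) (ha1 : a < 1) (hb0 : 0 < b)
    (hb1 : b < 1) (hA : HasSum (fun k => c k * a ^ (k + 1)) A)
    (hB : HasSum (fun k => c k * b ^ (k + 1)) B)
    (hD : HasSum (fun k => c k * (a * b) ^ (k + 1)) D) : A * B < L * D := by
  have hcs : Summable c := summable_of_sum_range_le (fun k => (hc k).le) hL
  set C := ∑' k, c k with hCdef
  have hC : HasSum c C := hcs.hasSum
  have hCL : C ≤ L := hcs.tsum_le_of_sum_range_le hL
  have hC0 : 0 < C := hcs.tsum_pos (fun k => (hc k).le) 0 (hc 0)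
  have hA0 : 0 < A := by
    rw [← hA.tsum_eq]
    exact hA.summable.tsum_pos (fun k => by have := hc k; positivity) 0
      (by have := hc 0; positivity)
  have hD0 : 0 < D := by
    rw [← hD.tsum_eq]
    exact hD.summable.tsum_pos (fun k => by have := hc k; positivity) 0
      (by have := hc 0; positivity)
  have hex : ∃ K : ℕ, a ^ (K + 1) < A / C := by
    obtain ⟨K, hK⟩ := exists_pow_lt_of_lt_one (div_pos hA0 hC0) ha1
    exact ⟨K, lt_of_le_of_lt (pow_le_pow_of_le_one ha0.le ha1.le K.le_succ) hK⟩
  set K := Nat.find hex with hKdef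
  have hKs : a ^ (K + 1) < A / C := Nat.find_spec hex
  have hK0 : K ≠ 0 := by
    intro h0
    rw [h0] at hKs
    have : A ≤ C * a := by
      refine hasSum_le (fun k => ?_) hA (hC.mul_right a)
      refine mul_le_mul_of_nonneg_left ?_ (hc k).le
      calc a ^ (k + 1) ≤ a ^ 1 := pow_le_pow_of_le_one ha0.le ha1.le (by omega)
        _ = a := pow_one a
    rw [lt_div_iff₀ hC0] at hKs
    simp at hKs
    linarith
  have hs : HasSum (fun k => c k * ((a ^ (k + 1) - A / C) * (b ^ (k + 1) - b ^ K)))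
      (D - A / C * B - b ^ K * (A - A / C * C)) := by
    have := ((hD.sub (hB.mul_left (A / C))).sub
      ((hA.sub (hC.mul_left (A / C))).mul_left (b ^ K)))
    refine this.congr_fun fun k => ?_
    rw [mul_pow]; ring
  have hpos : 0 < D - A / C * B - b ^ K * (A - A / C * C) := by
    rw [← hs.tsum_eq]
    refine hs.summable.tsum_pos (fun k => mul_nonneg (hc k).le ?_) K (mul_pos (hc K) ?_)
    · by_cases hk : k < K
      · have h1 : A / C ≤ a ^ (k + 1) := not_lt.1 (Nat.find_min hex hk)
        have h2 : b ^ K ≤ b ^ (k + 1) := pow_le_pow_of_le_one hb0.le hb1.le hk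
        exact mul_nonneg (by linarith) (by linarith)
      · have h1 : a ^ (k + 1) ≤ a ^ (K + 1) :=
          pow_le_pow_of_le_one ha0.le ha1.le (by omega)
        have h2 : b ^ (k + 1) ≤ b ^ K := pow_le_pow_of_le_one hb0.le hb1.le (by omega)
        exact mul_nonneg_of_nonpos_of_nonpos (by linarith) (by linarith)
    · have h2 : b ^ (K + 1) < b ^ K := pow_lt_pow_right_of_lt_one₀ hb0 hb1 K.lt_succ_self
      exact mul_pos_of_neg_of_neg (by linarith) (by linarith)
  have hACC : A / C * C = A := div_mul_cancel₀ _ hC0.ne'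
  rw [hACC] at hpos
  have h3 : A / C * B < D := by linarith
  have h4 : A * B < C * D := by
    have := mul_lt_mul_of_pos_left h3 hC0
    calc A * B = C * (A / C * B) := by field_simp
      _ < C * D := this
  nlinarith

lemma sum_range_le_log_two (n : ℕ) :
    ∑ k ∈ Finset.range n, 1 / ((2 * (k : ℝ) + 1) * (2 * k + 2)) ≤ Real.log 2 := by
  have hcont : Filter.Tendsto (fun x : ℝ => ∑ k ∈ Finset.range n,
      1 / ((2 * (k : ℝ) + 1) * (2 * k + 2)) * (x ^ 2) ^ (k + 1)) (nhdsWithin 1 (Set.Iio 1))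
      (nhds (∑ k ∈ Finset.range n, 1 / ((2 * (k : ℝ) + 1) * (2 * k + 2)))) := by
    refine tendsto_nhdsWithin_of_tendsto_nhds ?_
    have : Continuous (fun x : ℝ => ∑ k ∈ Finset.range n,
      1 / ((2 * (k : ℝ) + 1) * (2 * k + 2)) * (x ^ 2) ^ (k + 1)) := by fun_prop
    simpa using this.tendsto 1
  refine le_of_tendsto hcont ?_
  filter_upwards [Ioo_mem_nhdsLT (show (0 : ℝ) < 1 by norm_num)] with x hx
  have hx' : |x| < 1 := abs_lt.2 ⟨by linarith [hx.1], hx.2⟩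
  have h := hasSum_log_two_sub_binEntropy hx'
  have h1 := sum_le_hasSum (Finset.range n) (fun k _ => by positivity) h
  refine h1.trans ?_
  have := Real.binEntropy_nonneg (p := (1 - x) / 2) (by linarith [hx.2]) (by linarith [hx.1])
  linarith

/-- A strict form of the linear upper bound in Mrs. Gerber's lemma. -/
lemma binEntropy_bconv_lt {p q : ℝ} (hp0 : 0 < p) (hp : p < 1 / 2) (hq0 : 1 / 2 < q)
    (hq1 : q < 1) :
    (Real.log 2 - Real.binEntropy p) * (Real.log 2 - Real.binEntropy q)
      < Real.log 2 * (Real.log 2 - Real.binEntropy (bconv p q)) := by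
  have h1 := hasSum_log_two_sub_binEntropy (x := 1 - 2 * p) (abs_lt.2 ⟨by linarith, by linarith⟩)
  have h2 := hasSum_log_two_sub_binEntropy (x := 1 - 2 * q) (abs_lt.2 ⟨by linarith, by linarith⟩)
  have h3 := hasSum_log_two_sub_binEntropy (x := (1 - 2 * p) * (1 - 2 * q))
    (abs_lt.2 ⟨by nlinarith, by nlinarith⟩)
  have e1 : (1 - (1 - 2 * p)) / 2 = p := by ring
  have e2 : (1 - (1 - 2 * q)) / 2 = q := by ring
  have e3 : (1 - (1 - 2 * p) * (1 - 2 * q)) / 2 = bconv p q := by unfold bconv; ring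
  rw [e1] at h1; rw [e2] at h2; rw [e3] at h3
  rw [mul_pow] at h3
  exact mul_lt_mul_of_hasSum_pow (fun k => by positivity) sum_range_le_log_two
    (by nlinarith) (by nlinarith) (by nlinarith) (by nlinarith) h1 h2 h3

lemma binEntropy_add_mul_log_two_le {q : ℝ} (hq0 : 0 < q) (hq1 : q < 1) :
    Real.binEntropy q + q * Real.log 2 ≤ Real.log 3 := by
  have h1 := Real.log_le_sub_one_of_pos (show 0 < 2 / (3 * q) by positivity)
  have h1' : 0 < 1 - q := by linarith
  have h2 := Real.log_le_sub_one_of_pos (show 0 < 1 / (3 * (1 - q)) by positivity)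
  have h3 := mul_le_mul_of_nonneg_left h1 hq0.le
  have h4 := mul_le_mul_of_nonneg_left h2 h1'.le
  have e1 : q * (2 / (3 * q) - 1) = 2 / 3 - q := by field_simp
  have e2 : (1 - q) * (1 / (3 * (1 - q)) - 1) = 1 / 3 - (1 - q) := by field_simp
  rw [e1, Real.log_div two_ne_zero (by positivity), Real.log_mul (by norm_num) hq0.ne'] at h3
  rw [e2, Real.log_div one_ne_zero (by positivity), Real.log_mul (by norm_num) h1'.ne',
    Real.log_one] at h4
  rw [Real.binEntropy, Real.log_inv, Real.log_inv]
  linarith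

lemma binEntropy_bconv_add_lt {p q : ℝ} (hp0 : 0 < p) (hp : p < 1 / 2) (hq0 : 0 ≤ q)
    (hq1 : q ≤ 1) :
    Real.binEntropy (bconv p q) - Real.binEntropy p + (Real.log 2 - Real.binEntropy p) * q
      < (Real.log 2 - Real.binEntropy p) * (Real.log 3 / Real.log 2) := by
  have hl2 : 0 < Real.log 2 := Real.log_pos (by norm_num)
  have hl23 : Real.log 2 < Real.log 3 := Real.log_lt_log (by norm_num) (by norm_num)
  have hl89 : 3 * Real.log 2 < 2 * Real.log 3 := by
    have : Real.log ((2 : ℝ) ^ 3) < Real.log ((3 : ℝ) ^ 2) :=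
      Real.log_lt_log (by norm_num) (by norm_num)
    rwa [Real.log_pow, Real.log_pow] at this
  have hc : 0 < Real.log 2 - Real.binEntropy p := by
    have : Real.binEntropy p < Real.log 2 := Real.binEntropy_lt_log_two.2 (by norm_num; linarith)
    linarith
  have key : ∀ r : ℝ, 1 / 2 < r → r ≤ 1 →
      Real.binEntropy (bconv p r) - Real.binEntropy p + (Real.log 2 - Real.binEntropy p) * r
      < (Real.log 2 - Real.binEntropy p) * (Real.log 3 / Real.log 2) := by
    intro r hr0 hr1
    rw [mul_div_assoc', lt_div_iff₀ hl2]
    rcases hr1.eq_or_lt with rfl | hr1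
    · have : bconv p 1 = 1 - p := by unfold bconv; ring
      rw [this, Real.binEntropy_one_sub]
      nlinarith
    · have h1 := binEntropy_bconv_lt hp0 hp hr0 hr1
      have h2 := binEntropy_add_mul_log_two_le (by linarith : 0 < r) hr1
      have h3 := mul_le_mul_of_nonneg_left h2 hc.le
      nlinarith
  rcases lt_trichotomy q (1 / 2) with h | h | h
  · have h1 := key (1 - q) (by linarith) (by linarith)
    have : bconv p (1 - q) = 1 - bconv p q := by unfold bconv; ring
    rw [this, Real.binEntropy_one_sub] at h1
    nlinarith
  · subst h
    have : bconv p (1 / 2) = 2⁻¹ := by unfold bconv; ring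
    rw [this, Real.binEntropy_two_inv, mul_div_assoc' _ (Real.log 3), lt_div_iff₀ hl2]
    nlinarith
  · exact key q h hq1

lemma continuous_bconv (p : ℝ) : Continuous (bconv p) := by
  unfold bconv; fun_prop

/-- The per-letter sum-rate bound without feedback (in nats) is uniformly below
`(1 - h(p)) log 3`. -/
lemma exists_sum_rate_bound {p : ℝ} (hp0 : 0 < p) (hp : p < 1 / 2) :
    ∃ T < (Real.log 2 - Real.binEntropy p) * (Real.log 3 / Real.log 2), 0 ≤ T ∧
      ∀ q, 0 ≤ q → q ≤ 1 → Real.binEntropy (bconv p q) - Real.binEntropy p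
        + (Real.log 2 - Real.binEntropy p) * q ≤ T := by
  have hcont : Continuous fun q => Real.binEntropy (bconv p q) - Real.binEntropy p
      + (Real.log 2 - Real.binEntropy p) * q := by
    have := continuous_bconv p
    fun_prop
  obtain ⟨q, hq, hmax⟩ := (isCompact_Icc (a := (0 : ℝ)) (b := 1)).exists_isMaxOn
    ⟨0, by norm_num⟩ hcont.continuousOn
  refine ⟨_, binEntropy_bconv_add_lt hp0 hp hq.1 hq.2, ?_, fun r h0 h1 => hmax ⟨h0, h1⟩⟩
  refine le_trans (le_of_eq ?_) (hmax (show (0 : ℝ) ∈ Set.Icc 0 1 by norm_num))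
  simp [bconv]

lemma binEntropy_bconv_sub_le {p q r : ℝ} (hp0 : 0 < p) (hp : p < 1 / 2) (hr0 : 0 ≤ r)
    (hrq : r ≤ q) (hq1 : q ≤ 1) :
    Real.binEntropy (bconv p r) - Real.binEntropy (bconv p q)
      ≤ (Real.log 2 - Real.binEntropy p) * q := by
  have hc : Real.binEntropy p ≤ Real.log 2 := Real.binEntropy_le_log_two
  have hq0 : 0 ≤ q := hr0.trans hrq
  rcases le_total q (1 / 2) with h | h
  · have := Real.binEntropy_strictMonoOn.monotoneOn (a := bconv p r) (b := bconv p q)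
      ⟨by unfold bconv; nlinarith, by unfold bconv; nlinarith⟩
      ⟨by unfold bconv; nlinarith, by unfold bconv; nlinarith⟩ (by unfold bconv; nlinarith)
    nlinarith
  · have h1 : Real.binEntropy (bconv p r) ≤ Real.log 2 := Real.binEntropy_le_log_two
    have h2 := Real.strictConcave_binEntropy.concaveOn.2 (show (2⁻¹ : ℝ) ∈ Set.Icc 0 1 by norm_num)
      (show 1 - p ∈ Set.Icc (0 : ℝ) 1 from ⟨by linarith, by linarith⟩)
      (show 0 ≤ 2 - 2 * q by linarith) (show 0 ≤ 2 * q - 1 by linarith) (by ring)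
    simp only [smul_eq_mul, Real.binEntropy_two_inv, Real.binEntropy_one_sub] at h2
    have e : (2 - 2 * q) * 2⁻¹ + (2 * q - 1) * (1 - p) = bconv p q := by unfold bconv; ring
    rw [e] at h2
    nlinarith

lemma negMulLog_add_sub {u v : ℝ} (hu : 0 ≤ u) (hv : 0 ≤ v) (h : 0 < u + v) :
    Real.negMulLog u + Real.negMulLog v - Real.negMulLog (u + v)
      = (u + v) * Real.binEntropy (v / (u + v)) := by
  have key : ∀ w, 0 ≤ w → (u + v) * Real.negMulLog (w / (u + v))
      = Real.negMulLog w + w * Real.log (u + v) := by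
    intro w hw
    rcases hw.eq_or_lt with rfl | hw
    · simp
    · rw [Real.negMulLog, Real.negMulLog, Real.log_div hw.ne' h.ne']
      field_simp; ring
  have e : 1 - v / (u + v) = u / (u + v) := by field_simp; ring
  rw [Real.binEntropy_eq_negMulLog_add_negMulLog_one_sub, e, mul_add, key _ hu, key _ hv]
  simp only [Real.negMulLog]; ring

/-- Unnormalised form of `binEntropy_bconv_sub_le`, for the weights `x`, `y`, `z` of the three
input letters. -/
lemma negMulLog_sub_le {p x y z : ℝ} (hp0 : 0 < p) (hp : p < 1 / 2) (hx : 0 ≤ x) (hy : 0 ≤ y)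
    (hz : 0 ≤ z) :
    Real.negMulLog (p * z + (1 - p) * (x + y)) + Real.negMulLog ((1 - p) * z + p * (x + y))
      - (Real.negMulLog (p * (y + z) + (1 - p) * x) + Real.negMulLog ((1 - p) * (y + z) + p * x))
      ≤ (Real.log 2 - Real.binEntropy p) * (y + z) := by
  have h1p : 0 < 1 - p := by linarith
  rcases (show 0 ≤ x + y + z by positivity).eq_or_lt with h | h
  · have hx' : x = 0 := by linarith
    have hy' : y = 0 := by linarith
    have hz' : z = 0 := by linarith
    simp [hx', hy', hz']
  · have a1 := negMulLog_add_sub (u := p * z + (1 - p) * (x + y))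
      (v := (1 - p) * z + p * (x + y)) (by positivity) (by positivity) (by nlinarith)
    have a2 := negMulLog_add_sub (u := p * (y + z) + (1 - p) * x)
      (v := (1 - p) * (y + z) + p * x) (by positivity) (by positivity) (by nlinarith)
    have s1 : p * z + (1 - p) * (x + y) + ((1 - p) * z + p * (x + y)) = x + y + z := by ring
    have s2 : p * (y + z) + (1 - p) * x + ((1 - p) * (y + z) + p * x) = x + y + z := by ring
    rw [s1] at a1; rw [s2] at a2
    have e1 : ((1 - p) * z + p * (x + y)) / (x + y + z) = bconv p (z / (x + y + z)) := by
      unfold bconv; field_simp; ring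
    have e2 : ((1 - p) * (y + z) + p * x) / (x + y + z) = bconv p ((y + z) / (x + y + z)) := by
      unfold bconv; field_simp; ring
    rw [e1] at a1; rw [e2] at a2
    have h3 := binEntropy_bconv_sub_le hp0 hp (r := z / (x + y + z)) (q := (y + z) / (x + y + z))
      (by positivity) (by gcongr; linarith) (by rw [div_le_one h]; linarith)
    have h4 := mul_le_mul_of_nonneg_left h3 h.le
    have e5 : (x + y + z) * ((Real.log 2 - Real.binEntropy p) * ((y + z) / (x + y + z)))
      = (Real.log 2 - Real.binEntropy p) * (y + z) := by field_simp
    rw [e5] at h4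
    linarith

lemma card_mul_sum_eq_sum_update {ι β : Type*} [Fintype ι] [DecidableEq ι] [Fintype β]
    [DecidableEq β] (j : ι) (φ : (ι → β) → ℝ) :
    (Fintype.card β : ℝ) * ∑ y, φ y = ∑ y, ∑ b, φ (Function.update y j b) := by
  have h : ∑ z : (ι → β) × β, φ z.1
      = ∑ z : (ι → β) × β, φ (Function.update z.1 j z.2) := by
    refine Finset.sum_nbij' (fun z => (Function.update z.1 j z.2, z.1 j))
      (fun z => (Function.update z.1 j z.2, z.1 j)) ?_ ?_ ?_ ?_ ?_ <;> simp
  rw [Fintype.sum_prod_type, Fintype.sum_prod_type] at h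
  rw [← h]
  simp [Finset.mul_sum]

/-- Transition probabilities of the binary symmetric channel. -/
def bsc (p : ℝ) (s b : Bool) : ℝ := if b = s then 1 - p else p

/-- Law of the output block of a binary symmetric channel with input block `u`. -/
def bscBlock (p : ℝ) {n : ℕ} (u y : Fin n → Bool) : ℝ := ∏ t, bsc p (u t) (y t)

/-- Output law of a binary symmetric channel when the input block is `u i` with weight `w i`. -/
def bscMix {I : Type*} [Fintype I] (p : ℝ) {n : ℕ} (w : I → ℝ) (u : I → Fin n → Bool)
    (y : Fin n → Bool) : ℝ := ∑ i, w i * bscBlock p (u i) y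

/-- Shannon entropy in nats. -/
def natEnt {Y : Type*} [Fintype Y] (f : Y → ℝ) : ℝ := ∑ y, Real.negMulLog (f y)

section

variable {p : ℝ}

lemma sum_bsc (s : Bool) : ∑ b, bsc p s b = 1 := by
  cases s <;> simp [bsc]

lemma bsc_pos (hp0 : 0 < p) (hp1 : p < 1) (s b : Bool) : 0 < bsc p s b := by
  unfold bsc; split_ifs <;> linarith

lemma bscBlock_pos (hp0 : 0 < p) (hp1 : p < 1) {n : ℕ} (u y : Fin n → Bool) :
    0 < bscBlock p u y := Finset.prod_pos fun _ _ => bsc_pos hp0 hp1 _ _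

lemma sum_bscBlock {n : ℕ} (u : Fin n → Bool) : ∑ y, bscBlock p u y = 1 := by
  unfold bscBlock
  rw [← Fintype.prod_sum (fun t b => bsc p (u t) b)]
  simp only [sum_bsc, Finset.prod_const_one]

lemma bscBlock_update {n : ℕ} (u y : Fin n → Bool) (j : Fin n) (b : Bool) :
    bscBlock p u (Function.update y j b)
      = bsc p (u j) b * ∏ t ∈ Finset.univ.erase j, bsc p (u t) (y t) := by
  unfold bscBlock
  rw [← Finset.mul_prod_erase _ _ (Finset.mem_univ j), Function.update_self]
  congr 1
  refine Finset.prod_congr rfl fun t ht => ?_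
  rw [Function.update_of_ne (Finset.ne_of_mem_erase ht)]

lemma sum_prod_erase_bsc {n : ℕ} (u : Fin n → Bool) (j : Fin n) :
    ∑ y : Fin n → Bool, ∏ t ∈ Finset.univ.erase j, bsc p (u t) (y t) = 2 := by
  have h := card_mul_sum_eq_sum_update j (bscBlock p u)
  simp only [bscBlock_update, ← Finset.sum_mul, sum_bsc, one_mul, sum_bscBlock] at h
  rw [← h]; simp

lemma sum_bscBlock_mul {n : ℕ} (u : Fin n → Bool) (j : Fin n) (f : Bool → ℝ) :
    ∑ y, bscBlock p u y * f (y j) = ∑ b, bsc p (u j) b * f b := by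
  have h := card_mul_sum_eq_sum_update j (fun y => bscBlock p u y * f (y j))
  simp only [bscBlock_update, Function.update_self] at h
  have h2 : ∀ y : Fin n → Bool, ∑ b, bsc p (u j) b *
      (∏ t ∈ Finset.univ.erase j, bsc p (u t) (y t)) * f b
      = (∏ t ∈ Finset.univ.erase j, bsc p (u t) (y t)) * ∑ b, bsc p (u j) b * f b := by
    intro y
    rw [Finset.mul_sum]
    exact Finset.sum_congr rfl fun b _ => by ring
  simp only [h2, ← Finset.sum_mul, sum_prod_erase_bsc, Fintype.card_bool] at h
  push_cast at h
  linarith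

lemma natEnt_bscBlock (hp0 : 0 < p) (hp1 : p < 1) {n : ℕ} (u : Fin n → Bool) :
    natEnt (bscBlock p u) = n * Real.binEntropy p := by
  have h1 : ∀ y, Real.negMulLog (bscBlock p u y)
      = ∑ t, bscBlock p u y * (-Real.log (bsc p (u t) (y t))) := by
    intro y
    rw [Real.negMulLog, bscBlock, Real.log_prod fun t _ => (bsc_pos hp0 hp1 _ _).ne',
      ← Finset.mul_sum, Finset.sum_neg_distrib]
    ring
  unfold natEnt
  simp only [h1]
  rw [Finset.sum_comm]
  have h2 : ∀ t, ∑ y, bscBlock p u y * (-Real.log (bsc p (u t) (y t))) = Real.binEntropy p := by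
    intro t
    rw [sum_bscBlock_mul u t (fun b => -Real.log (bsc p (u t) b))]
    cases u t <;> simp [bsc, Real.binEntropy]
    ring
  simp only [h2, Finset.sum_const, Finset.card_univ, Fintype.card_fin, nsmul_eq_mul]

variable {I : Type*} [Fintype I] {w : I → ℝ} {n : ℕ}

lemma bscMix_update (u : I → Fin n → Bool) (y : Fin n → Bool) (j : Fin n) (b : Bool) :
    bscMix p w u (Function.update y j b)
      = ∑ i, bsc p (u i j) b * (w i * ∏ t ∈ Finset.univ.erase j, bsc p (u i t) (y t)) := by
  unfold bscMix
  simp only [bscBlock_update]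
  exact Finset.sum_congr rfl fun i _ => by ring

lemma sum_bscMix (u : I → Fin n → Bool) : ∑ y, bscMix p w u y = ∑ i, w i := by
  unfold bscMix
  rw [Finset.sum_comm]
  simp [← Finset.mul_sum, sum_bscBlock]

lemma bscMix_nonneg (hp0 : 0 < p) (hp1 : p < 1) (hw : ∀ i, 0 ≤ w i) (u : I → Fin n → Bool)
    (y : Fin n → Bool) : 0 ≤ bscMix p w u y :=
  Finset.sum_nonneg fun i _ => mul_nonneg (hw i) (bscBlock_pos hp0 hp1 _ _).le

lemma natEnt_bscMix_step (hp0 : 0 < p) (hp : p < 1 / 2) (hw : ∀ i, 0 ≤ w i)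
    (u u' : I → Fin n → Bool) (j : Fin n) (hne : ∀ i t, t ≠ j → u' i t = u i t)
    (hle : ∀ i, u' i j = true → u i j = true) :
    natEnt (bscMix p w u') - natEnt (bscMix p w u)
      ≤ (Real.log 2 - Real.binEntropy p) * ∑ i, if u i j then w i else 0 := by
  set R : I → (Fin n → Bool) → ℝ := fun i y => ∏ t ∈ Finset.univ.erase j, bsc p (u i t) (y t)
    with hR
  have hR0 : ∀ i y, 0 ≤ w i * R i y := fun i y =>
    mul_nonneg (hw i) (Finset.prod_nonneg fun t _ => (bsc_pos hp0 (by linarith) _ _).le)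
  have hu : ∀ y b, bscMix p w u (Function.update y j b) = ∑ i, bsc p (u i j) b * (w i * R i y) :=
    fun y b => bscMix_update u y j b
  have hu' : ∀ y b, bscMix p w u' (Function.update y j b)
      = ∑ i, bsc p (u' i j) b * (w i * R i y) := by
    intro y b
    rw [bscMix_update]
    refine Finset.sum_congr rfl fun i _ => ?_
    congr 2
    exact Finset.prod_congr rfl fun t ht => by rw [hne i t (Finset.ne_of_mem_erase ht)]
  have hc : ∀ i, (u i j = true ∧ u' i j = true) ∨ (u i j = true ∧ u' i j = false) ∨
      (u i j = false ∧ u' i j = false) := by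
    intro i
    have := hle i
    revert this
    cases u i j <;> cases u' i j <;> decide
  have key : ∀ y, ∑ b, Real.negMulLog (bscMix p w u' (Function.update y j b))
      - ∑ b, Real.negMulLog (bscMix p w u (Function.update y j b))
      ≤ (Real.log 2 - Real.binEntropy p) * ∑ i, if u i j then w i * R i y else 0 := by
    intro y
    set x := ∑ i, if u i j then 0 else w i * R i y with hx
    set m := ∑ i, if u i j = true ∧ u' i j = false then w i * R i y else 0 with hm
    set z := ∑ i, if u' i j then w i * R i y else 0 with hz
    have hx0 : 0 ≤ x := Finset.sum_nonneg fun i _ => by split_ifs <;> [rfl; exact hR0 i y]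
    have hm0 : 0 ≤ m := Finset.sum_nonneg fun i _ => by split_ifs <;> [exact hR0 i y; rfl]
    have hz0 : 0 ≤ z := Finset.sum_nonneg fun i _ => by split_ifs <;> [exact hR0 i y; rfl]
    have e := negMulLog_sub_le hp0 hp hx0 hm0 hz0
    have e1 : ∑ i, (if u i j then w i * R i y else 0) = m + z := by
      rw [hm, hz, ← Finset.sum_add_distrib]
      refine Finset.sum_congr rfl fun i _ => ?_
      rcases hc i with ⟨h, h'⟩ | ⟨h, h'⟩ | ⟨h, h'⟩ <;> simp [h, h']
    have e2 : ∑ i, bsc p (u' i j) true * (w i * R i y) = (1 - p) * z + p * (x + m) := by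
      rw [hm, hz, hx, ← Finset.sum_add_distrib, Finset.mul_sum, Finset.mul_sum,
        ← Finset.sum_add_distrib]
      refine Finset.sum_congr rfl fun i _ => ?_
      rcases hc i with ⟨h, h'⟩ | ⟨h, h'⟩ | ⟨h, h'⟩ <;> simp [h, h', bsc]
    have e3 : ∑ i, bsc p (u' i j) false * (w i * R i y) = p * z + (1 - p) * (x + m) := by
      rw [hm, hz, hx, ← Finset.sum_add_distrib, Finset.mul_sum, Finset.mul_sum,
        ← Finset.sum_add_distrib]
      refine Finset.sum_congr rfl fun i _ => ?_
      rcases hc i with ⟨h, h'⟩ | ⟨h, h'⟩ | ⟨h, h'⟩ <;> simp [h, h', bsc]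
    have e4 : ∑ i, bsc p (u i j) true * (w i * R i y) = (1 - p) * (m + z) + p * x := by
      rw [hm, hz, hx, ← Finset.sum_add_distrib, Finset.mul_sum, Finset.mul_sum,
        ← Finset.sum_add_distrib]
      refine Finset.sum_congr rfl fun i _ => ?_
      rcases hc i with ⟨h, h'⟩ | ⟨h, h'⟩ | ⟨h, h'⟩ <;> simp [h, h', bsc]
    have e5 : ∑ i, bsc p (u i j) false * (w i * R i y) = p * (m + z) + (1 - p) * x := by
      rw [hm, hz, hx, ← Finset.sum_add_distrib, Finset.mul_sum, Finset.mul_sum,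
        ← Finset.sum_add_distrib]
      refine Finset.sum_congr rfl fun i _ => ?_
      rcases hc i with ⟨h, h'⟩ | ⟨h, h'⟩ | ⟨h, h'⟩ <;> simp [h, h', bsc]
    simp only [Fintype.sum_bool, hu, hu', e1, e2, e3, e4, e5]
    linarith
  have h1 := card_mul_sum_eq_sum_update j (fun y => Real.negMulLog (bscMix p w u' y))
  have h2 := card_mul_sum_eq_sum_update j (fun y => Real.negMulLog (bscMix p w u y))
  have h3 := Finset.sum_le_sum fun y (_ : y ∈ Finset.univ) => key y
  rw [Finset.sum_sub_distrib, ← h1, ← h2, ← Finset.mul_sum, Finset.sum_comm,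
    Fintype.card_bool] at h3
  have h4 : ∀ i, ∑ y, (if u i j then w i * R i y else 0) = 2 * if u i j then w i else 0 := by
    intro i
    split_ifs
    · rw [← Finset.mul_sum, hR, sum_prod_erase_bsc]; ring
    · simp
  simp only [h4, ← Finset.mul_sum] at h3
  unfold natEnt
  push_cast at h3
  linarith

lemma natEnt_bscMix_sub_le (hp0 : 0 < p) (hp : p < 1 / 2) (hw : ∀ i, 0 ≤ w i)
    (u v : I → Fin n → Bool) (hle : ∀ i t, v i t = true → u i t = true) :
    natEnt (bscMix p w v) - natEnt (bscMix p w u)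
      ≤ (Real.log 2 - Real.binEntropy p) * ∑ t, ∑ i, if u i t then w i else 0 := by
  have key : ∀ A : Finset (Fin n),
      natEnt (bscMix p w fun i t => if t ∈ A then v i t else u i t) - natEnt (bscMix p w u)
      ≤ (Real.log 2 - Real.binEntropy p) * ∑ t ∈ A, ∑ i, if u i t then w i else 0 := by
    intro A
    induction A using Finset.induction_on with
    | empty => simp
    | insert j A hj ih =>
      have := natEnt_bscMix_step hp0 hp hw (fun i t => if t ∈ A then v i t else u i t)
        (fun i t => if t ∈ insert j A then v i t else u i t) j
        (fun i t ht => by simp [Finset.mem_insert, ht]) (fun i => by simpa [hj] using hle i j)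
      rw [Finset.sum_insert hj, mul_add]
      simp only [hj, if_false] at this
      linarith
  simpa using key Finset.univ

lemma mul_log_sub_le {a b : ℝ} (ha : 0 ≤ a) (hb : 0 < b) :
    a * (Real.log b - Real.log a) ≤ b - a := by
  rcases ha.eq_or_lt with rfl | ha
  · simpa using hb.le
  · have := mul_le_mul_of_nonneg_left (Real.log_le_sub_one_of_pos (div_pos hb ha)) ha.le
    rw [Real.log_div hb.ne' ha.ne'] at this
    have e : a * (b / a - 1) = b - a := by field_simp
    linarith

lemma natEnt_bscMix_le (hp0 : 0 < p) (hp : p < 1 / 2) (hw : ∀ i, 0 ≤ w i) (hw1 : ∑ i, w i = 1)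
    (u : I → Fin n → Bool) :
    natEnt (bscMix p w u)
      ≤ ∑ t, Real.binEntropy (bconv p (∑ i, if u i t then w i else 0)) := by
  set q : Fin n → ℝ := fun t => ∑ i, if u i t then w i else 0 with hq
  have hq0 : ∀ t, 0 ≤ q t := fun t => Finset.sum_nonneg fun i _ => by
    split_ifs <;> [exact hw i; rfl]
  have hq1 : ∀ t, q t ≤ 1 := fun t => by
    rw [← hw1]
    exact Finset.sum_le_sum fun i _ => by split_ifs <;> [rfl; exact hw i]
  set Q : Fin n → Bool → ℝ := fun t b => if b then bconv p (q t) else 1 - bconv p (q t) with hQ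
  have hQ0 : ∀ t b, 0 < Q t b := by
    intro t b
    have := hq0 t
    have := hq1 t
    simp only [hQ, bconv]
    split_ifs <;> nlinarith
  have hQ1 : ∀ t, ∑ b, Q t b = 1 := fun t => by simp [hQ]
  have hQm : ∀ t (f : Bool → ℝ), ∑ i, w i * ∑ b, bsc p (u i t) b * f b = ∑ b, Q t b * f b := by
    intro t f
    simp only [Fintype.sum_bool, hQ, if_true]
    have e0 : (∑ i, if u i t then w i else 0) = q t := rfl
    have e1 : ∑ i, w i * (bsc p (u i t) true * f true + bsc p (u i t) false * f false)
        = (∑ i, w i) * (p * f true + (1 - p) * f false)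
          + (∑ i, if u i t then w i else 0) * ((1 - 2 * p) * (f true - f false)) := by
      rw [Finset.sum_mul, Finset.sum_mul, ← Finset.sum_add_distrib]
      refine Finset.sum_congr rfl fun i _ => ?_
      cases u i t <;> simp [bsc]
      ring
    rw [e1, hw1, e0]
    simp [bconv]
    ring
  have hprod : ∑ y : Fin n → Bool, ∏ t, Q t (y t) = 1 := by
    rw [← Fintype.prod_sum]; simp only [hQ1, Finset.prod_const_one]
  have hP1 : ∑ y, bscMix p w u y = 1 := by rw [sum_bscMix, hw1]
  have h1 : ∀ y, Real.negMulLog (bscMix p w u y)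
      + ∑ t, bscMix p w u y * Real.log (Q t (y t)) ≤ (∏ t, Q t (y t)) - bscMix p w u y := by
    intro y
    have := mul_log_sub_le (bscMix_nonneg hp0 (by linarith) hw u y)
      (Finset.prod_pos fun t (_ : t ∈ Finset.univ) => hQ0 t (y t))
    rw [Real.log_prod fun t _ => (hQ0 t (y t)).ne'] at this
    rw [← Finset.mul_sum, Real.negMulLog]
    linarith
  have h2 := Finset.sum_le_sum fun y (_ : y ∈ Finset.univ) => h1 y
  rw [Finset.sum_sub_distrib, hprod, hP1, Finset.sum_add_distrib, Finset.sum_comm] at h2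
  have h3 : ∀ t, ∑ y, bscMix p w u y * Real.log (Q t (y t))
      = -Real.binEntropy (bconv p (q t)) := by
    intro t
    unfold bscMix
    simp only [Finset.sum_mul]
    rw [Finset.sum_comm]
    simp only [mul_assoc, ← Finset.mul_sum]
    simp only [sum_bscBlock_mul (u _) t (fun b => Real.log (Q t b))]
    rw [hQm t (fun b => Real.log (Q t b))]
    simp [hQ, Real.binEntropy]; ring
  simp only [h3, Finset.sum_neg_distrib] at h2
  unfold natEnt
  linarith

end

/-- Fano's inequality for a uniformly distributed message. -/
lemma fano {M Y : Type*} [Fintype M] [Nonempty M] [DecidableEq M] [Fintype Y] (P : M → Y → ℝ)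
    (hP : ∀ m y, 0 ≤ P m y) (hP1 : ∀ m, ∑ y, P m y = 1) (d : Y → M) :
    (∑ m, ∑ y, (Fintype.card M : ℝ)⁻¹ * (P m y * if d y = m then 1 else 0))
        * Real.log (Fintype.card M)
      ≤ natEnt (fun y => ∑ m, (Fintype.card M : ℝ)⁻¹ * P m y)
        - ∑ m, (Fintype.card M : ℝ)⁻¹ * natEnt (P m) + Real.log 2 := by
  set N : ℝ := (Fintype.card M : ℝ) with hN
  have hN1 : 1 ≤ N := by
    rw [hN]; exact_mod_cast Fintype.card_pos
  have hN0 : 0 < N := by linarith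
  set Q : Y → ℝ := fun y => ∑ m, N⁻¹ * P m y with hQ
  have hQ0 : ∀ y, 0 ≤ Q y := fun y => Finset.sum_nonneg fun m _ => by
    have := hP m y; positivity
  have hQP : ∀ m y, P m y ≤ N * Q y := by
    intro m y
    rw [hQ, Finset.mul_sum]
    have : P m y = N * (N⁻¹ * P m y) := by field_simp
    rw [this]
    exact Finset.single_le_sum (f := fun m => N * (N⁻¹ * P m y))
      (fun m _ => by have := hP m y; positivity) (Finset.mem_univ m)
  have hQ1 : ∑ y, Q y = 1 := by
    rw [hQ, Finset.sum_comm]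
    simp only [← Finset.mul_sum, hP1]
    simp [hN.symm, hN0.ne']
  have h1 : ∀ m y, P m y * ((if d y = m then 1 else 0) * Real.log N)
      - P m y * Real.log 2 + P m y * Real.log (Q y) + Real.negMulLog (P m y)
      ≤ Q y / 2 + (if d y = m then Q y * (N - 1) / 2 else 0) - P m y := by
    intro m y
    rcases (hP m y).eq_or_lt with h | h
    · rw [← h]
      have := hQ0 y
      have : 0 ≤ Q y * (N - 1) / 2 := by
        have := mul_nonneg this (sub_nonneg.2 hN1)
        linarith
      simp
      split_ifs <;> linarith
    · have hq : 0 < Q y := by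
        have := hQP m y
        by_contra hc
        nlinarith
      split_ifs
      · have := mul_log_sub_le h.le (show 0 < Q y * N / 2 by positivity)
        rw [Real.log_div (by positivity) two_ne_zero, Real.log_mul hq.ne' hN0.ne'] at this
        rw [Real.negMulLog]
        linarith
      · have := mul_log_sub_le h.le (show 0 < Q y / 2 by positivity)
        rw [Real.log_div hq.ne' two_ne_zero] at this
        rw [Real.negMulLog]
        linarith
  have h2 := Finset.sum_le_sum fun m (_ : m ∈ Finset.univ) =>
    Finset.sum_le_sum fun y (_ : y ∈ Finset.univ) => h1 m y
  simp only [Finset.sum_sub_distrib, Finset.sum_add_distrib, hP1] at h2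
  have a1 : ∑ m : M, ∑ y, Q y / 2 = N / 2 := by
    simp only [← Finset.sum_div, hQ1]
    simp [hN]
  have a2 : ∑ m, ∑ y, (if d y = m then Q y * (N - 1) / 2 else 0) = (N - 1) / 2 := by
    rw [Finset.sum_comm]
    simp only [Finset.sum_ite_eq, Finset.mem_univ, if_true]
    rw [← Finset.sum_div, ← Finset.sum_mul, hQ1, one_mul]
  have a3 : ∑ m : M, ∑ y, P m y * Real.log 2 = N * Real.log 2 := by
    simp only [← Finset.sum_mul, hP1]
    simp [hN]
  have a4 : ∑ m, ∑ y, P m y * Real.log (Q y) = - N * natEnt Q := by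
    rw [Finset.sum_comm, natEnt, Finset.mul_sum]
    refine Finset.sum_congr rfl fun y _ => ?_
    rw [← Finset.sum_mul, Real.negMulLog]
    have : Q y = N⁻¹ * ∑ m, P m y := by rw [hQ, Finset.mul_sum]
    have h' : ∑ m, P m y = N * Q y := by rw [this]; field_simp
    rw [h']; ring
  have a5 : ∑ m, ∑ y, P m y * ((if d y = m then 1 else 0) * Real.log N)
      = N * ((∑ m, ∑ y, N⁻¹ * (P m y * if d y = m then 1 else 0)) * Real.log N) := by
    simp only [← Finset.mul_sum]
    rw [mul_assoc, ← mul_assoc, mul_inv_cancel₀ hN0.ne', one_mul, Finset.sum_mul]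
    simp only [Finset.sum_mul, mul_assoc]
  have a6 : ∑ m, ∑ y, Real.negMulLog (P m y) = N * ∑ m, N⁻¹ * natEnt (P m) := by
    rw [← Finset.mul_sum, ← mul_assoc, mul_inv_cancel₀ hN0.ne', one_mul]; rfl
  have a7 : ∑ m : M, (1 : ℝ) = N := by simp [hN]
  rw [a1, a2, a3, a4, a5, a6, a7] at h2
  have h3 : N * ((∑ m, ∑ y, N⁻¹ * (P m y * if d y = m then 1 else 0)) * Real.log N)
      ≤ N * (natEnt Q - ∑ m, N⁻¹ * natEnt (P m) + Real.log 2) := by linarith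
  exact le_of_mul_le_mul_left h3 hN0

/-- Noiseless input of the first receiver. -/
def letter1 (x : Fin 3) : Bool := decide (1 ≤ (x : ℕ))

/-- Noiseless input of the second receiver. -/
def letter2 (x : Fin 3) : Bool := decide ((x : ℕ) = 2)

lemma letter1_of_letter2 (x : Fin 3) (h : letter2 x = true) : letter1 x = true := by
  revert h; revert x; decide

section

variable {p : ℝ}

lemma sum_blackwellW_snd (x : Fin 3) (b : Bool) :
    ∑ b', blackwellW p x (b, b') = bsc p (letter1 x) b := by
  fin_cases x <;> cases b <;> simp [blackwellW, bsc, letter1]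

lemma sum_blackwellW_fst (x : Fin 3) (b : Bool) :
    ∑ b', blackwellW p x (b', b) = bsc p (letter2 x) b := by
  fin_cases x <;> cases b <;> simp [blackwellW, bsc, letter2]

lemma blackwellW_nonneg (hp0 : 0 < p) (hp1 : p < 1) (x : Fin 3) (y : Bool × Bool) :
    0 ≤ blackwellW p x y := by
  unfold blackwellW
  refine Finset.sum_nonneg fun z _ => mul_nonneg ?_ ?_ <;> split_ifs <;> linarith

lemma sum_prod_eq_sum_sum {n : ℕ} (F : (Fin n → Bool × Bool) → ℝ) :
    ∑ y, F y = ∑ y1 : Fin n → Bool, ∑ y2 : Fin n → Bool, F fun t => (y1 t, y2 t) := by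
  rw [← Fintype.sum_prod_type']
  exact Fintype.sum_equiv (Equiv.arrowProdEquivProdArrow _ _ _) _ _ fun y => rfl

lemma sum_blackwell_fst {n : ℕ} (x : Fin n → Fin 3) (f : (Fin n → Bool) → ℝ) :
    ∑ y : Fin n → Bool × Bool, (∏ t, blackwellW p (x t) (y t)) * f (fun t => (y t).1)
      = ∑ y, bscBlock p (fun t => letter1 (x t)) y * f y := by
  rw [sum_prod_eq_sum_sum]
  refine Finset.sum_congr rfl fun y1 _ => ?_
  simp only [← Finset.sum_mul]
  rw [← Fintype.prod_sum (fun t b => blackwellW p (x t) (y1 t, b))]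
  simp only [sum_blackwellW_snd, bscBlock]

lemma sum_blackwell_snd {n : ℕ} (x : Fin n → Fin 3) (f : (Fin n → Bool) → ℝ) :
    ∑ y : Fin n → Bool × Bool, (∏ t, blackwellW p (x t) (y t)) * f (fun t => (y t).2)
      = ∑ y, bscBlock p (fun t => letter2 (x t)) y * f y := by
  rw [sum_prod_eq_sum_sum, Finset.sum_comm]
  refine Finset.sum_congr rfl fun y1 _ => ?_
  simp only [← Finset.sum_mul]
  rw [← Fintype.prod_sum (fun t b => blackwellW p (x t) (b, y1 t))]
  simp only [sum_blackwellW_fst, bscBlock]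

lemma sum_blackwell {n : ℕ} (x : Fin n → Fin 3) :
    ∑ y : Fin n → Bool × Bool, ∏ t, blackwellW p (x t) (y t) = 1 := by
  have := sum_blackwell_fst (p := p) x (fun _ => 1)
  simpa [sum_bscBlock] using this

lemma sum_rate_converse (hp0 : 0 < p) (hp : p < 1 / 2) {T : ℝ}
    (hT : ∀ q, 0 ≤ q → q ≤ 1 → Real.binEntropy (bconv p q) - Real.binEntropy p
        + (Real.log 2 - Real.binEntropy p) * q ≤ T)
    {M1 M2 : Type*} [Fintype M1] [Fintype M2] [Nonempty M1] [Nonempty M2] {n : ℕ}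
    (x : M1 → M2 → Fin n → Fin 3) (d1 : (Fin n → Bool) → M1) (d2 : (Fin n → Bool) → M2) :
    (1 - ∑ m1, (Fintype.card M1 : ℝ)⁻¹ * ∑ m2, (Fintype.card M2 : ℝ)⁻¹ *
        ∑ y : Fin n → Bool × Bool, (∏ t, blackwellW p (x m1 m2 t) (y t)) *
          (if d1 (fun t => (y t).1) ≠ m1 ∨ d2 (fun t => (y t).2) ≠ m2 then 1 else 0))
      * (Real.log (Fintype.card M1) + Real.log (Fintype.card M2)) ≤ n * T + 2 * Real.log 2 := by
  have hp1 : p < 1 := by linarith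
  set N1 : ℝ := (Fintype.card M1 : ℝ) with hN1
  set N2 : ℝ := (Fintype.card M2 : ℝ) with hN2
  have hN1' : 1 ≤ N1 := by rw [hN1]; exact_mod_cast Fintype.card_pos
  have hN2' : 1 ≤ N2 := by rw [hN2]; exact_mod_cast Fintype.card_pos
  have i1 : 0 < N1⁻¹ := by positivity
  have i2 : 0 < N2⁻¹ := by positivity
  have w1 : ∑ _m : M1, N1⁻¹ = 1 := by
    simp [hN1.symm]
  have w2 : ∑ _m : M2, N2⁻¹ = 1 := by
    simp [hN2.symm]
  set u : M1 → M2 → Fin n → Bool := fun m1 m2 t => letter1 (x m1 m2 t) with hu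
  set v : M1 → M2 → Fin n → Bool := fun m1 m2 t => letter2 (x m1 m2 t) with hv
  set q : Fin n → ℝ := fun t => ∑ m1, N1⁻¹ * ∑ m2, if u m1 m2 t then N2⁻¹ else 0 with hq
  set E : M1 → M2 → ℝ := fun m1 m2 => ∑ y : Fin n → Bool × Bool,
    (∏ t, blackwellW p (x m1 m2 t) (y t)) *
      (if d1 (fun t => (y t).1) ≠ m1 ∨ d2 (fun t => (y t).2) ≠ m2 then 1 else 0) with hE
  have hs1 : ∀ m1 m2, 1 - E m1 m2
      ≤ ∑ y, bscBlock p (u m1 m2) y * (if d1 y = m1 then 1 else 0) := by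
    intro m1 m2
    have e := sum_blackwell (p := p) (x m1 m2)
    rw [← sum_blackwell_fst (x m1 m2) (fun y => if d1 y = m1 then 1 else 0), sub_le_iff_le_add,
      hE, ← Finset.sum_add_distrib]
    refine e.symm.le.trans ?_
    refine Finset.sum_le_sum fun y _ => ?_
    have : 0 ≤ ∏ t, blackwellW p (x m1 m2 t) (y t) :=
      Finset.prod_nonneg fun t _ => blackwellW_nonneg hp0 hp1 _ _
    by_cases h : d1 (fun t => (y t).1) = m1
    · simp only [h, ne_eq, not_true_eq_false, false_or, if_true]
      split_ifs <;> linarith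
    · simp [h]
  have hs2 : ∀ m1 m2, 1 - E m1 m2
      ≤ ∑ y, bscBlock p (v m1 m2) y * (if d2 y = m2 then 1 else 0) := by
    intro m1 m2
    have e := sum_blackwell (p := p) (x m1 m2)
    rw [← sum_blackwell_snd (x m1 m2) (fun y => if d2 y = m2 then 1 else 0), sub_le_iff_le_add,
      hE, ← Finset.sum_add_distrib]
    refine e.symm.le.trans ?_
    refine Finset.sum_le_sum fun y _ => ?_
    have : 0 ≤ ∏ t, blackwellW p (x m1 m2 t) (y t) :=
      Finset.prod_nonneg fun t _ => blackwellW_nonneg hp0 hp1 _ _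
    by_cases h : d2 (fun t => (y t).2) = m2
    · simp only [h, ne_eq, not_true_eq_false, or_false, if_true]
      split_ifs <;> linarith
    · simp [h]
  have hav : 1 - ∑ m1, N1⁻¹ * ∑ m2, N2⁻¹ * E m1 m2
      = ∑ m1, N1⁻¹ * ∑ m2, N2⁻¹ * (1 - E m1 m2) := by
    simp only [mul_sub, mul_one, Finset.sum_sub_distrib, w2, w1]
  -- the first receiver
  have f1 := fano (fun m1 y => bscMix p (fun _ : M2 => N2⁻¹) (u m1) y)
    (fun m1 y => bscMix_nonneg hp0 hp1 (fun _ => i2.le) _ _)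
    (fun m1 => by rw [sum_bscMix, w2]) d1
  rw [← hN1] at f1
  have g1 : (fun y => ∑ m1, N1⁻¹ * bscMix p (fun _ : M2 => N2⁻¹) (u m1) y)
      = bscMix p (fun _ : M1 × M2 => N1⁻¹ * N2⁻¹) (fun m => u m.1 m.2) := by
    funext y
    unfold bscMix
    rw [Fintype.sum_prod_type]
    refine Finset.sum_congr rfl fun m1 _ => ?_
    rw [Finset.mul_sum]
    exact Finset.sum_congr rfl fun m2 _ => by ring
  rw [g1] at f1
  have h1 := natEnt_bscMix_le hp0 hp (fun _ => (mul_pos i1 i2).le)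
    (by rw [Fintype.sum_prod_type]; simp only [← Finset.mul_sum, w2, mul_one, w1])
    (w := fun _ : M1 × M2 => N1⁻¹ * N2⁻¹) (fun m => u m.1 m.2)
  have hqt : ∀ t, (∑ m : M1 × M2, if u m.1 m.2 t then N1⁻¹ * N2⁻¹ else 0) = q t := by
    intro t
    rw [Fintype.sum_prod_type, hq]
    refine Finset.sum_congr rfl fun m1 _ => ?_
    rw [Finset.mul_sum]
    exact Finset.sum_congr rfl fun m2 _ => by split_ifs <;> simp
  simp only [hqt] at h1
  have k1 : 1 - ∑ m1, N1⁻¹ * ∑ m2, N2⁻¹ * E m1 m2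
      ≤ ∑ m1, ∑ y, N1⁻¹ * (bscMix p (fun _ : M2 => N2⁻¹) (u m1) y
        * if d1 y = m1 then 1 else 0) := by
    rw [hav]
    refine Finset.sum_le_sum fun m1 _ => ?_
    refine le_trans ?_ (Finset.mul_sum _ _ _).le
    refine mul_le_mul_of_nonneg_left ?_ i1.le
    unfold bscMix
    simp only [Finset.sum_mul]
    rw [Finset.sum_comm]
    refine Finset.sum_le_sum fun m2 _ => ?_
    simp only [mul_assoc]
    refine le_trans ?_ (Finset.mul_sum _ _ _).le
    exact mul_le_mul_of_nonneg_left (hs1 m1 m2) i2.le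
  -- the second receiver, given the first message
  have f2 : ∀ m1, (∑ m2, N2⁻¹ * (1 - E m1 m2)) * Real.log N2
      ≤ natEnt (bscMix p (fun _ : M2 => N2⁻¹) (v m1)) - n * Real.binEntropy p + Real.log 2 := by
    intro m1
    have f := fano (fun m2 y => bscBlock p (v m1 m2) y) (fun m2 y => (bscBlock_pos hp0 hp1 _ _).le)
      (fun m2 => sum_bscBlock _) d2
    rw [← hN2] at f
    simp only [natEnt_bscBlock hp0 hp1, ← Finset.sum_mul, w2, one_mul] at f
    refine le_trans ?_ f
    refine mul_le_mul_of_nonneg_right ?_ (Real.log_nonneg hN2')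
    refine Finset.sum_le_sum fun m2 _ => ?_
    refine le_trans ?_ (Finset.mul_sum _ _ _).le
    exact mul_le_mul_of_nonneg_left (hs2 m1 m2) i2.le
  have f3 : ∀ m1, (∑ m2, N2⁻¹ * (1 - E m1 m2)) * Real.log N2
      ≤ natEnt (bscMix p (fun _ : M2 => N2⁻¹) (u m1))
        + (Real.log 2 - Real.binEntropy p) * ∑ t, ∑ m2, (if u m1 m2 t then N2⁻¹ else 0)
        - n * Real.binEntropy p + Real.log 2 := by
    intro m1
    have := natEnt_bscMix_sub_le hp0 hp (w := fun _ : M2 => N2⁻¹) (fun _ => i2.le) (u m1) (v m1)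
      (fun m2 t => letter1_of_letter2 _)
    have := f2 m1
    linarith
  have f4 := Finset.sum_le_sum fun m1 (_ : m1 ∈ Finset.univ) =>
    mul_le_mul_of_nonneg_left (f3 m1) i1.le
  have e4 : ∑ m1, N1⁻¹ * (natEnt (bscMix p (fun _ : M2 => N2⁻¹) (u m1))
        + (Real.log 2 - Real.binEntropy p) * ∑ t, ∑ m2, (if u m1 m2 t then N2⁻¹ else 0)
        - n * Real.binEntropy p + Real.log 2)
      = ∑ m1, N1⁻¹ * natEnt (bscMix p (fun _ : M2 => N2⁻¹) (u m1))
        + (Real.log 2 - Real.binEntropy p) * ∑ t, q t - n * Real.binEntropy p + Real.log 2 := by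
    have e : ∑ m1, N1⁻¹ * ∑ t, ∑ m2, (if u m1 m2 t then N2⁻¹ else 0) = ∑ t, q t := by
      rw [hq, Finset.sum_comm]
      exact Finset.sum_congr rfl fun m1 _ => Finset.mul_sum _ _ _
    have e' : n * Real.binEntropy p = ∑ _m1 : M1, N1⁻¹ * (n * Real.binEntropy p) := by
      rw [← Finset.sum_mul, w1, one_mul]
    have e'' : Real.log 2 = ∑ _m1 : M1, N1⁻¹ * Real.log 2 := by
      rw [← Finset.sum_mul, w1, one_mul]
    calc _ = ∑ m1, (N1⁻¹ * natEnt (bscMix p (fun _ : M2 => N2⁻¹) (u m1))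
        + (Real.log 2 - Real.binEntropy p)
          * (N1⁻¹ * ∑ t, ∑ m2, (if u m1 m2 t then N2⁻¹ else 0))
        - N1⁻¹ * (n * Real.binEntropy p) + N1⁻¹ * Real.log 2) :=
          Finset.sum_congr rfl fun m1 _ => by ring
      _ = _ := by
        rw [Finset.sum_add_distrib, Finset.sum_sub_distrib, Finset.sum_add_distrib, ← e', ← e'',
          ← e, Finset.mul_sum _ _ (Real.log 2 - Real.binEntropy p)]
  have e5 : ∑ m1, N1⁻¹ * ((∑ m2, N2⁻¹ * (1 - E m1 m2)) * Real.log N2)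
      = (1 - ∑ m1, N1⁻¹ * ∑ m2, N2⁻¹ * E m1 m2) * Real.log N2 := by
    rw [hav, Finset.sum_mul]
    exact Finset.sum_congr rfl fun m1 _ => by ring
  rw [e4, e5] at f4
  have hq0 : ∀ t, 0 ≤ q t := fun t => Finset.sum_nonneg fun m1 _ => mul_nonneg i1.le
    (Finset.sum_nonneg fun m2 _ => by split_ifs <;> [exact i2.le; rfl])
  have hq1 : ∀ t, q t ≤ 1 := fun t => by
    rw [← w1]
    refine Finset.sum_le_sum fun m1 _ => mul_le_of_le_one_right i1.le ?_
    rw [← w2]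
    exact Finset.sum_le_sum fun m2 _ => by split_ifs <;> [rfl; exact i2.le]
  have h5 := Finset.sum_le_sum fun t (_ : t ∈ Finset.univ) => hT (q t) (hq0 t) (hq1 t)
  simp only [Finset.sum_add_distrib, Finset.sum_sub_distrib, ← Finset.mul_sum, Finset.sum_const,
    Finset.card_univ, Fintype.card_fin, nsmul_eq_mul] at h5
  have h6 := mul_le_mul_of_nonneg_right k1 (Real.log_nonneg hN1')
  rw [mul_add]
  linarith

end

lemma one_le_two_rpow {n : ℕ} {R : ℝ} (hR : 0 ≤ R) : (1 : ℝ) ≤ 2 ^ ((n : ℝ) * R) :=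
  Real.one_le_rpow (by norm_num) (by positivity)

lemma msgCard_pos {n : ℕ} {R : ℝ} (hR : 0 ≤ R) : 0 < msgCard n R :=
  Nat.floor_pos.2 (one_le_two_rpow hR)

lemma msgCard_le {n : ℕ} {R : ℝ} : (msgCard n R : ℝ) ≤ 2 ^ ((n : ℝ) * R) :=
  Nat.floor_le (by positivity)

lemma two_rpow_le_two_mul_msgCard {n : ℕ} {R : ℝ} (hR : 0 ≤ R) :
    (2 : ℝ) ^ ((n : ℝ) * R) ≤ 2 * msgCard n R := by
  have h1 : (2 : ℝ) ^ ((n : ℝ) * R) < msgCard n R + 1 := Nat.lt_floor_add_one _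
  have h2 : (1 : ℝ) ≤ msgCard n R := by exact_mod_cast msgCard_pos hR
  linarith

lemma msgCard_zero (n : ℕ) : msgCard n 0 = 1 := by simp [msgCard]

lemma sub_log_two_le_log_msgCard {n : ℕ} {R : ℝ} (hR : 0 ≤ R) :
    n * R * Real.log 2 - Real.log 2 ≤ Real.log (msgCard n R) := by
  have h := Real.log_le_log (by positivity) (two_rpow_le_two_mul_msgCard (n := n) hR)
  have h2 : (0 : ℝ) < msgCard n R := by exact_mod_cast msgCard_pos hR
  rw [Real.log_rpow (by norm_num), Real.log_mul (by norm_num) h2.ne'] at h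
  linarith

lemma one_sub_errProbNoFB_mul_le {p : ℝ} (hp0 : 0 < p) (hp : p < 1 / 2) {T : ℝ}
    (hT : ∀ q, 0 ≤ q → q ≤ 1 → Real.binEntropy (bconv p q) - Real.binEntropy p
        + (Real.log 2 - Real.binEntropy p) * q ≤ T) {n : ℕ} {R0 R1 R2 : ℝ} (hR0 : 0 ≤ R0)
    (hR1 : 0 ≤ R1) (hR2 : 0 ≤ R2)
    (enc : Fin (msgCard n R0) × Fin (msgCard n R1) × Fin (msgCard n R2) → Fin n → Fin 3)
    (dec1 : (Fin n → Bool) → Fin (msgCard n R0) × Fin (msgCard n R1))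
    (dec2 : (Fin n → Bool) → Fin (msgCard n R0) × Fin (msgCard n R2)) :
    (1 - errProbNoFB (blackwellW p) n R0 R1 R2 enc dec1 dec2)
      * (Real.log (msgCard n R1) + Real.log (msgCard n R2)) ≤ n * T + 2 * Real.log 2 := by
  have p0 := msgCard_pos (n := n) hR0
  have p1 := msgCard_pos (n := n) hR1
  have p2 := msgCard_pos (n := n) hR2
  have : Nonempty (Fin (msgCard n R1)) := ⟨⟨0, p1⟩⟩
  have : Nonempty (Fin (msgCard n R2)) := ⟨⟨0, p2⟩⟩
  set L : ℝ := Real.log (msgCard n R1) + Real.log (msgCard n R2) with hL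
  have hL0 : 0 ≤ L := add_nonneg (Real.log_natCast_nonneg _) (Real.log_natCast_nonneg _)
  set b : Fin (msgCard n R0) → ℝ := fun m0 => ∑ m1, (msgCard n R1 : ℝ)⁻¹ *
    ∑ m2, (msgCard n R2 : ℝ)⁻¹ *
      ∑ y : Fin n → Bool × Bool, (∏ t, blackwellW p (enc (m0, m1, m2) t) (y t)) *
        (if dec1 (fun t => (y t).1) ≠ (m0, m1) ∨ dec2 (fun t => (y t).2) ≠ (m0, m2)
          then 1 else 0) with hb
  have h1 : ∀ m0, (1 - b m0) * L ≤ n * T + 2 * Real.log 2 := by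
    intro m0
    have h := sum_rate_converse hp0 hp hT (fun m1 m2 t => enc (m0, m1, m2) t)
      (fun y => (dec1 y).2) (fun y => (dec2 y).2)
    simp only [Fintype.card_fin] at h
    refine le_trans (mul_le_mul_of_nonneg_right (sub_le_sub_left ?_ _) hL0) h
    refine Finset.sum_le_sum fun m1 _ => mul_le_mul_of_nonneg_left ?_ (by positivity)
    refine Finset.sum_le_sum fun m2 _ => mul_le_mul_of_nonneg_left ?_ (by positivity)
    refine Finset.sum_le_sum fun y _ => mul_le_mul_of_nonneg_left ?_
      (Finset.prod_nonneg fun t _ => blackwellW_nonneg hp0 (by linarith) _ _)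
    have e1 : (dec1 fun t => (y t).1).2 ≠ m1 → dec1 (fun t => (y t).1) ≠ (m0, m1) :=
      fun h h' => h (by rw [h'])
    have e2 : (dec2 fun t => (y t).2).2 ≠ m2 → dec2 (fun t => (y t).2) ≠ (m0, m2) :=
      fun h h' => h (by rw [h'])
    split_ifs with i1 i2
    · rfl
    · exact absurd (i1.imp e1 e2) i2
    · exact zero_le_one
    · rfl
  have h2 : errProbNoFB (blackwellW p) n R0 R1 R2 enc dec1 dec2
      = (msgCard n R0 : ℝ)⁻¹ * ∑ m0, b m0 := by
    rw [errProbNoFB, Fintype.sum_prod_type, hb, Finset.mul_sum, Finset.mul_sum]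
    refine Finset.sum_congr rfl fun m0 _ => ?_
    rw [Fintype.sum_prod_type]
    simp only [← Finset.mul_sum]
    rw [one_div, mul_inv, mul_inv]
    ring
  have h3 := Finset.sum_le_sum fun m0 (_ : m0 ∈ Finset.univ) => h1 m0
  rw [← Finset.sum_mul, Finset.sum_sub_distrib] at h3
  simp only [Finset.sum_const, Finset.card_univ, Fintype.card_fin, nsmul_eq_mul, mul_one] at h3
  have h4 : (0 : ℝ) < msgCard n R0 := by exact_mod_cast p0
  rw [h2]
  refine le_of_mul_le_mul_left ?_ h4
  refine le_trans (le_of_eq ?_) h3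
  rw [← mul_assoc, mul_sub, ← mul_assoc, mul_inv_cancel₀ h4.ne']
  ring

/-- Weak converse for the sum-rate without feedback. -/
lemma AchievableNoFB.sum_rate_le {p : ℝ} (hp0 : 0 < p) (hp : p < 1 / 2) {T : ℝ}
    (hT : ∀ q, 0 ≤ q → q ≤ 1 → Real.binEntropy (bconv p q) - Real.binEntropy p
        + (Real.log 2 - Real.binEntropy p) * q ≤ T) {R0 R1 R2 : ℝ}
    (h : AchievableNoFB (blackwellW p) R0 R1 R2) : R1 + R2 ≤ T / Real.log 2 := by
  obtain ⟨hR0, hR1, hR2, enc, dec1, dec2, hlim⟩ := h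
  have hl2 : 0 < Real.log 2 := Real.log_pos (by norm_num)
  rw [le_div_iff₀ hl2]
  have hinv : Filter.Tendsto (fun n : ℕ => 2 * Real.log 2 * (n : ℝ)⁻¹) Filter.atTop (nhds 0) := by
    simpa using (tendsto_inv_atTop_nhds_zero_nat (𝕜 := ℝ)).const_mul (2 * Real.log 2)
  have l1 := (hlim.const_sub 1).mul (hinv.const_sub ((R1 + R2) * Real.log 2))
  have l2 := hinv.const_add T
  simp only [sub_zero, add_zero, one_mul] at l1 l2
  refine le_of_tendsto_of_tendsto l1 l2 ?_
  filter_upwards [hlim.eventually (gt_mem_nhds one_pos), Filter.eventually_gt_atTop 0]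
    with n hn hn0
  have hn0' : (0 : ℝ) < n := by exact_mod_cast hn0
  have h := one_sub_errProbNoFB_mul_le hp0 hp hT hR0 hR1 hR2 (enc n) (dec1 n) (dec2 n)
  have a1 := sub_log_two_le_log_msgCard (n := n) hR1
  have a2 := sub_log_two_le_log_msgCard (n := n) hR2
  have h' := (mul_le_mul_of_nonneg_left (add_le_add a1 a2) (sub_nonneg.2 hn.le)).trans h
  refine le_of_mul_le_mul_left ?_ hn0'
  have e1 : (n : ℝ) * (T + 2 * Real.log 2 * (n : ℝ)⁻¹) = n * T + 2 * Real.log 2 := by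
    field_simp
  rw [e1]
  refine le_trans (le_of_eq ?_) h'
  field_simp
  ring

lemma sum_rate_le_of_mem_CNoFB {p : ℝ} (hp0 : 0 < p) (hp : p < 1 / 2) {T : ℝ}
    (hT : ∀ q, 0 ≤ q → q ≤ 1 → Real.binEntropy (bconv p q) - Real.binEntropy p
        + (Real.log 2 - Real.binEntropy p) * q ≤ T) {r : ℝ × ℝ × ℝ}
    (h : r ∈ CNoFB (blackwellW p)) : r.2.1 + r.2.2 ≤ T / Real.log 2 := by
  have hc : IsClosed {r : ℝ × ℝ × ℝ | r.2.1 + r.2.2 ≤ T / Real.log 2} :=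
    isClosed_le (by fun_prop) continuous_const
  exact closure_minimal (fun r hr => AchievableNoFB.sum_rate_le hp0 hp hT hr) hc h

lemma sum_noiselessExt {X Y1 Y2 : Type*} [Fintype Y1] [Fintype Y2] (W : X → Y1 × Y2 → ℝ) {n : ℕ}
    (g : Fin n → (Fin n → Y1 × Y2) → X) (F : (Fin n → Y1 × Y2 × (Y1 × Y2)) → ℝ) :
    ∑ y, (∏ t, noiselessExt W (g t fun s => (y s).2.2) (y t)) * F y
      = ∑ z : Fin n → Y1 × Y2, (∏ t, W (g t z) (z t)) * F fun t => ((z t).1, (z t).2, z t) := by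
  symm
  refine Fintype.sum_of_injective (fun z t => ((z t).1, (z t).2, z t)) ?_ _ _ ?_ ?_
  · intro z z' h
    funext t
    exact congrArg (fun y => y.2.2) (congrFun h t)
  · intro y hy
    have : ∃ t, (y t).2.2 ≠ ((y t).1, (y t).2.1) := by
      by_contra! hc
      refine hy ⟨fun t => (y t).2.2, funext fun t => ?_⟩
      change ((y t).2.2.1, (y t).2.2.2, (y t).2.2) = y t
      rw [hc t]
      exact Prod.ext rfl (Prod.ext rfl (hc t).symm)
    obtain ⟨t, ht⟩ := this
    rw [Finset.prod_eq_zero (Finset.mem_univ t), zero_mul]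
    simp [noiselessExt, ht]
  · intro z
    simp [noiselessExt]

/-- Error probability with noiseless feedback as a sum over the channel outputs only. -/
lemma errProbFB_noiselessExt {X Y1 Y2 : Type*} [Fintype X] [Fintype Y1] [Fintype Y2]
    (W : X → Y1 × Y2 → ℝ) {n : ℕ} {R0 R1 R2 : ℝ}
    (enc : Fin n → Fin (msgCard n R0) × Fin (msgCard n R1) × Fin (msgCard n R2) →
      (Fin n → Y1 × Y2) → X)
    (dec1 : (Fin n → Y1) → Fin (msgCard n R0) × Fin (msgCard n R1))
    (dec2 : (Fin n → Y2) → Fin (msgCard n R0) × Fin (msgCard n R2)) :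
    errProbFB (noiselessExt W) n R0 R1 R2 enc dec1 dec2
      = (1 / ((msgCard n R0 : ℝ) * (msgCard n R1 : ℝ) * (msgCard n R2 : ℝ))) *
        ∑ m, ∑ z : Fin n → Y1 × Y2, (∏ t, W (enc t m z) (z t)) *
          (if dec1 (fun t => (z t).1) ≠ (m.1, m.2.1) ∨ dec2 (fun t => (z t).2) ≠ (m.1, m.2.2)
            then 1 else 0) := by
  unfold errProbFB
  congr 1
  exact Finset.sum_congr rfl fun m _ => sum_noiselessExt W (fun t => enc t m)
    (fun y => if dec1 (fun t => (y t).1) ≠ (m.1, m.2.1) ∨ dec2 (fun t => (y t).2.1) ≠ (m.1, m.2.2)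
            then 1 else 0)

lemma AchievableNoFB.achievableFB {X Y1 Y2 : Type*} [Fintype X] [Fintype Y1] [Fintype Y2]
    {W : X → Y1 × Y2 → ℝ} {R0 R1 R2 : ℝ} (h : AchievableNoFB W R0 R1 R2) :
    AchievableFB (noiselessExt W) R0 R1 R2 := by
  obtain ⟨h0, h1, h2, enc, dec1, dec2, hlim⟩ := h
  refine ⟨h0, h1, h2, fun n t m _ => enc n m t, dec1, dec2, fun n t m fb fb' _ => rfl, ?_⟩
  simp only [errProbFB_noiselessExt]
  exact hlim

lemma CNoFB_subset_CNoiselessFB {X Y1 Y2 : Type*} [Fintype X] [Fintype Y1] [Fintype Y2]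
    (W : X → Y1 × Y2 → ℝ) : CNoFB W ⊆ CNoiselessFB W :=
  closure_mono fun _ hr => AchievableNoFB.achievableFB hr

/-- Input rule of a feedback code for a fixed message. -/
def CausalInput {n : ℕ} {Y X : Type*} (g : Fin n → (Fin n → Y) → X) : Prop :=
  ∀ (t : Fin n) (z z' : Fin n → Y), (∀ s : Fin n, (s : ℕ) < (t : ℕ) → z s = z' s) → g t z = g t z'

/-- Output of the Blackwell channel for input `x` and noise bit `b`. -/
def blackwellOut (x : Fin 3) (b : Bool) : Bool × Bool :=
  (Bool.xor (letter1 x) b, Bool.xor (letter2 x) b)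

lemma blackwellOut_injective (x : Fin 3) : Function.Injective (blackwellOut x) := by
  revert x; decide

lemma blackwellW_out (p : ℝ) (x : Fin 3) (b : Bool) :
    blackwellW p x (blackwellOut x b) = bsc p false b := by
  fin_cases x <;> cases b <;> simp [blackwellW, bsc, blackwellOut, letter1, letter2]

lemma blackwellW_eq_zero (p : ℝ) (x : Fin 3) (y : Bool × Bool) (h : ∀ b, y ≠ blackwellOut x b) :
    blackwellW p x y = 0 := by
  refine Finset.sum_eq_zero fun b _ => ?_
  exact mul_eq_zero_of_right _ (if_neg (h b))

lemma exists_blackwellOut_fixed {n : ℕ} {g : Fin n → (Fin n → Bool × Bool) → Fin 3}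
    (hg : CausalInput g) (ν : Fin n → Bool) : ∃ z, ∀ t, z t = blackwellOut (g t z) (ν t) := by
  have key : ∀ k : ℕ, ∃ z : Fin n → Bool × Bool,
      ∀ t : Fin n, (t : ℕ) < k → z t = blackwellOut (g t z) (ν t) := by
    intro k
    induction k with
    | zero => exact ⟨fun _ => (false, false), fun t h => absurd h (Nat.not_lt_zero _)⟩
    | succ k ih =>
      obtain ⟨z, hz⟩ := ih
      by_cases hk : k < n
      · refine ⟨Function.update z ⟨k, hk⟩ (blackwellOut (g ⟨k, hk⟩ z) (ν ⟨k, hk⟩)), ?_⟩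
        intro t ht
        have e : g t (Function.update z ⟨k, hk⟩ (blackwellOut (g ⟨k, hk⟩ z) (ν ⟨k, hk⟩)))
            = g t z := by
          refine hg t _ _ fun s hs => Function.update_of_ne ?_ _ _
          rintro rfl
          simp at hs
          omega
        rw [e]
        by_cases hkt : t = ⟨k, hk⟩
        · subst hkt; simp
        · rw [Function.update_of_ne hkt]
          exact hz t (lt_of_le_of_ne (Nat.lt_succ_iff.1 ht) fun h => hkt (Fin.ext h))
      · exact ⟨z, fun t _ => hz t (by omega)⟩
  obtain ⟨z, hz⟩ := key n
  exact ⟨z, fun t => hz t t.2⟩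

lemma blackwellOut_fixed_unique {n : ℕ} {g : Fin n → (Fin n → Bool × Bool) → Fin 3}
    (hg : CausalInput g) {ν : Fin n → Bool} {z z' : Fin n → Bool × Bool}
    (h : ∀ t, z t = blackwellOut (g t z) (ν t)) (h' : ∀ t, z' t = blackwellOut (g t z') (ν t)) :
    z = z' := by
  have key : ∀ k : ℕ, ∀ t : Fin n, (t : ℕ) = k → z t = z' t := by
    intro k
    induction k using Nat.strong_induction_on with
    | _ k ih =>
      intro t ht
      rw [h t, h' t, hg t z z' fun s hs => ih s (ht ▸ hs) s rfl]
  exact funext fun t => key t t rfl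

/-- Change of variables from channel outputs to noise bits for a feedback code. -/
lemma exists_sum_feedback (p : ℝ) {n : ℕ} {g : Fin n → (Fin n → Bool × Bool) → Fin 3}
    (hg : CausalInput g) :
    ∃ out : (Fin n → Bool) → (Fin n → Bool × Bool),
      (∀ ν t, out ν t = blackwellOut (g t (out ν)) (ν t)) ∧
      ∀ F : (Fin n → Bool × Bool) → ℝ, ∑ z, (∏ t, blackwellW p (g t z) (z t)) * F z
        = ∑ ν, bscBlock p (fun _ => false) ν * F (out ν) := by
  choose out hout using exists_blackwellOut_fixed hg
  refine ⟨out, hout, fun F => ?_⟩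
  symm
  refine Fintype.sum_of_injective out ?_ _ _ ?_ ?_
  · intro ν ν' h
    funext t
    have h1 := hout ν t
    rw [h, hout ν' t] at h1
    exact (blackwellOut_injective _ h1).symm
  · intro z hz
    have : ∃ t, ∀ b, z t ≠ blackwellOut (g t z) b := by
      by_contra! hc
      choose ν hν using hc
      exact hz ⟨ν, blackwellOut_fixed_unique hg (hout ν) hν⟩
    obtain ⟨t, ht⟩ := this
    rw [Finset.prod_eq_zero (Finset.mem_univ t) (blackwellW_eq_zero p _ _ ht), zero_mul]
  · intro ν
    congr 1
    refine Finset.prod_congr rfl fun t _ => ?_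
    conv_rhs => rw [show blackwellW p (g t (out ν)) (out ν t)
      = blackwellW p (g t (out ν)) (blackwellOut (g t (out ν)) (ν t)) by rw [← hout ν t]]
    rw [blackwellW_out]

lemma sum_blackwell_feedback (p : ℝ) {n : ℕ} {g : Fin n → (Fin n → Bool × Bool) → Fin 3}
    (hg : CausalInput g) : ∑ z, ∏ t, blackwellW p (g t z) (z t) = 1 := by
  obtain ⟨out, -, h⟩ := exists_sum_feedback p hg
  have := h fun _ => 1
  simpa [sum_bscBlock] using this

lemma blackwellW_le_one {p : ℝ} (hp0 : 0 < p) (hp1 : p < 1) (x : Fin 3) (y : Bool × Bool) :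
    blackwellW p x y ≤ 1 := by
  by_cases h : ∃ b, y = blackwellOut x b
  · obtain ⟨b, rfl⟩ := h
    rw [blackwellW_out]
    unfold bsc
    split_ifs <;> linarith
  · rw [blackwellW_eq_zero p x y (not_exists.1 h)]
    exact zero_le_one

lemma one_sub_errProbFB_mul_le {p : ℝ} (hp0 : 0 < p) (hp1 : p < 1) {n : ℕ} {R0 R1 R2 : ℝ}
    (hR0 : 0 ≤ R0) (hR1 : 0 ≤ R1) (hR2 : 0 ≤ R2)
    {enc : Fin n → Fin (msgCard n R0) × Fin (msgCard n R1) × Fin (msgCard n R2) →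
      (Fin n → Bool × Bool) → Fin 3} (hc : Causal n enc)
    (dec1 : (Fin n → Bool) → Fin (msgCard n R0) × Fin (msgCard n R1))
    (dec2 : (Fin n → Bool) → Fin (msgCard n R0) × Fin (msgCard n R2)) :
    (1 - errProbFB (noiselessExt (blackwellW p)) n R0 R1 R2 enc dec1 dec2)
      * ((msgCard n R0 : ℝ) * (msgCard n R1 : ℝ) * (msgCard n R2 : ℝ)) ≤ 4 ^ n := by
  have p0 : (0 : ℝ) < msgCard n R0 := by exact_mod_cast msgCard_pos hR0
  have p1 : (0 : ℝ) < msgCard n R1 := by exact_mod_cast msgCard_pos hR1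
  have p2 : (0 : ℝ) < msgCard n R2 := by exact_mod_cast msgCard_pos hR2
  set N : ℝ := (msgCard n R0 : ℝ) * (msgCard n R1 : ℝ) * (msgCard n R2 : ℝ) with hN
  have hN0 : 0 < N := by positivity
  have hmass : ∑ m, ∑ z : Fin n → Bool × Bool, ∏ t, blackwellW p (enc t m z) (z t) = N := by
    have : ∀ m, ∑ z : Fin n → Bool × Bool, ∏ t, blackwellW p (enc t m z) (z t) = 1 :=
      fun m => sum_blackwell_feedback p fun t z z' h => hc t m z z' h
    simp only [this]
    simp [hN, mul_assoc]
  rw [errProbFB_noiselessExt, sub_mul, one_mul, ← hN, one_div, mul_right_comm,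
    inv_mul_cancel₀ hN0.ne', one_mul]
  conv_lhs => rw [← hmass]
  simp only [← Finset.sum_sub_distrib]
  have hcard : ∑ _z : Fin n → Bool × Bool, (1 : ℝ) = 4 ^ n := by
    simp
  rw [Finset.sum_comm, ← hcard]
  refine Finset.sum_le_sum fun z _ => ?_
  have h1 := Finset.sum_ite_eq Finset.univ
    ((dec1 fun t => (z t).1).1, (dec1 fun t => (z t).1).2, (dec2 fun t => (z t).2).2)
    (fun _ => (1 : ℝ))
  rw [if_pos (Finset.mem_univ _)] at h1
  refine le_trans (Finset.sum_le_sum fun m _ => ?_) h1.le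
  have hb0 : 0 ≤ ∏ t, blackwellW p (enc t m z) (z t) :=
    Finset.prod_nonneg fun t _ => blackwellW_nonneg hp0 hp1 _ _
  have hb1 : ∏ t, blackwellW p (enc t m z) (z t) ≤ 1 :=
    Finset.prod_le_one (fun t _ => blackwellW_nonneg hp0 hp1 _ _)
      fun t _ => blackwellW_le_one hp0 hp1 _ _
  split_ifs with i1 i2 i2
  · linarith
  · linarith
  · linarith
  · push Not at i1
    exact absurd (by rw [i1.1, i1.2]) i2

lemma AchievableFB.sum_rate_le {p : ℝ} (hp0 : 0 < p) (hp1 : p < 1) {R0 R1 R2 : ℝ}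
    (h : AchievableFB (noiselessExt (blackwellW p)) R0 R1 R2) : R1 + R2 ≤ 2 := by
  obtain ⟨hR0, hR1, hR2, enc, dec1, dec2, hc, hlim⟩ := h
  by_contra! hlt
  have hx : (1 : ℝ) < 2 ^ (R1 + R2 - 2) := Real.one_lt_rpow (by norm_num) (by linarith)
  have hgrow := (tendsto_pow_atTop_atTop_of_one_lt hx).eventually_gt_atTop 8
  obtain ⟨n, hn1, hn2⟩ := ((hlim.eventually (gt_mem_nhds (show (0 : ℝ) < 1 / 2 by norm_num))).and
    hgrow).exists
  have h := one_sub_errProbFB_mul_le hp0 hp1 hR0 hR1 hR2 (hc n) (dec1 n) (dec2 n)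
  have a0 : (1 : ℝ) ≤ msgCard n R0 := by exact_mod_cast msgCard_pos hR0
  have a1 := two_rpow_le_two_mul_msgCard (n := n) hR1
  have a2 := two_rpow_le_two_mul_msgCard (n := n) hR2
  have e : (2 : ℝ) ^ ((n : ℝ) * R1) * 2 ^ ((n : ℝ) * R2) = (2 ^ (R1 + R2 - 2)) ^ n * 4 ^ n := by
    rw [← Real.rpow_natCast, ← Real.rpow_mul (by norm_num),
      show (4 : ℝ) ^ n = 2 ^ ((n : ℝ) * 2) by
        rw [Real.rpow_mul (by norm_num), Real.rpow_natCast, ← Real.rpow_natCast, ← Real.rpow_natCast,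
          ← Real.rpow_mul (by norm_num), mul_comm, Real.rpow_mul (by norm_num)]
        norm_num,
      ← Real.rpow_add (by norm_num), ← Real.rpow_add (by norm_num)]
    congr 1; ring
  have a3 := mul_le_mul a1 a2 (by positivity) (by positivity)
  rw [e] at a3
  have hP : (0 : ℝ) < 4 ^ n := by positivity
  have a4 : (msgCard n R1 : ℝ) * msgCard n R2
      ≤ (msgCard n R0 : ℝ) * msgCard n R1 * msgCard n R2 := by
    rw [mul_assoc]
    exact le_mul_of_one_le_left (by positivity) a0
  have a5 : 8 * (4 : ℝ) ^ n < (2 ^ (R1 + R2 - 2)) ^ n * 4 ^ n := mul_lt_mul_of_pos_right hn2 hP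
  have a6 : 1 / 2 * ((msgCard n R1 : ℝ) * msgCard n R2) ≤ 4 ^ n := by
    refine le_trans ?_ h
    exact mul_le_mul (by linarith) a4 (by positivity) (by linarith)
  linarith

lemma sum_rate_le_of_mem_CNoiselessFB {p : ℝ} (hp0 : 0 < p) (hp1 : p < 1) {r : ℝ × ℝ × ℝ}
    (h : r ∈ CNoiselessFB (blackwellW p)) : r.2.1 + r.2.2 ≤ 2 := by
  have hc : IsClosed {r : ℝ × ℝ × ℝ | r.2.1 + r.2.2 ≤ 2} :=
    isClosed_le (by fun_prop) continuous_const
  exact closure_minimal (fun r hr => AchievableFB.sum_rate_le hp0 hp1 hr) hc h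

/-- Chernoff bound for sums of i.i.d. binary random variables with negative mean. -/
lemma exists_chernoff {w X : Bool → ℝ} (hw : ∀ b, 0 ≤ w b) (hw1 : ∑ b, w b = 1)
    (hX : ∑ b, w b * X b < 0) :
    ∃ r, 0 ≤ r ∧ r < 1 ∧ ∀ n : ℕ, ∑ y : Fin n → Bool,
      (∏ t, w (y t)) * (if 0 ≤ ∑ t, X (y t) then 1 else 0) ≤ r ^ n := by
  set f : ℝ → ℝ := fun l => ∑ b, w b * Real.exp (l * X b) with hf
  have hd : HasDerivAt f (∑ b, w b * X b) 0 := by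
    refine HasDerivAt.fun_sum fun b _ => ?_
    have := ((hasDerivAt_mul_const (x := (0 : ℝ)) (X b)).exp).const_mul (w b)
    simpa using this
  have hf0 : f 0 = 1 := by
    rw [← hw1]
    exact Finset.sum_congr rfl fun b _ => by rw [zero_mul, Real.exp_zero, mul_one]
  obtain ⟨l, hl0, hl1⟩ : ∃ l, 0 < l ∧ f l < 1 := by
    have hs := (hasDerivAt_iff_tendsto_slope.1 hd).mono_left
      (nhdsWithin_mono 0 (show Set.Ioi (0 : ℝ) ⊆ {0}ᶜ from fun x hx => ne_of_gt hx))
    have hev := (hs.eventually (gt_mem_nhds hX)).and self_mem_nhdsWithin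
    obtain ⟨l, h1, h2⟩ := hev.exists
    refine ⟨l, h2, ?_⟩
    rw [slope_def_field, hf0, sub_zero, div_neg_iff] at h1
    rcases h1 with h | h
    · exact absurd h2 (not_lt.2 h.2.le)
    · linarith [h.1]
  refine ⟨f l, Finset.sum_nonneg fun b _ => mul_nonneg (hw b) (Real.exp_pos _).le, hl1, ?_⟩
  intro n
  have e : f l ^ n = ∑ y : Fin n → Bool, (∏ t, w (y t)) * Real.exp (l * ∑ t, X (y t)) := by
    simp only [Finset.mul_sum, Real.exp_sum, ← Finset.prod_mul_distrib]
    rw [← Fintype.prod_sum (fun (_ : Fin n) b => w b * Real.exp (l * X b))]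
    simp [hf]
  rw [e]
  refine Finset.sum_le_sum fun y _ => mul_le_mul_of_nonneg_left ?_
    (Finset.prod_nonneg fun t _ => hw _)
  split_ifs with h
  · exact Real.one_le_exp (by positivity)
  · exact (Real.exp_pos _).le

/-- Weakly typical binary sequences. -/
def typicalSet (w : Bool → ℝ) (δ : ℝ) (n : ℕ) : Finset (Fin n → Bool) :=
  Finset.univ.filter fun y =>
    |∑ t, Real.log (w (y t)) + n * ∑ b, Real.negMulLog (w b)| < n * δ

lemma exists_sum_not_mem_typicalSet_le {w : Bool → ℝ} (hw : ∀ b, 0 ≤ w b) (hw1 : ∑ b, w b = 1)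
    {δ : ℝ} (hδ : 0 < δ) :
    ∃ r, 0 ≤ r ∧ r < 1 ∧ ∀ n : ℕ, ∑ y : Fin n → Bool,
      (∏ t, w (y t)) * (if y ∉ typicalSet w δ n then 1 else 0) ≤ 2 * r ^ n := by
  set H := ∑ b, Real.negMulLog (w b) with hH
  have hm : ∑ b, w b * (Real.log (w b) + H) = 0 := by
    simp only [mul_add, Finset.sum_add_distrib, ← Finset.sum_mul, hw1]
    simp [hH, Real.negMulLog]
  obtain ⟨r, hr0, hr1, hr⟩ := exists_chernoff (X := fun b => Real.log (w b) + H - δ) hw hw1 (by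
    simp only [mul_sub, Finset.sum_sub_distrib, hm, ← Finset.sum_mul, hw1]; linarith)
  obtain ⟨s, hs0, hs1, hs⟩ := exists_chernoff (X := fun b => -(Real.log (w b) + H) - δ) hw hw1 (by
    simp only [mul_sub, mul_neg, Finset.sum_sub_distrib, Finset.sum_neg_distrib, hm,
      ← Finset.sum_mul, hw1]; linarith)
  refine ⟨max r s, le_max_of_le_left hr0, max_lt hr1 hs1, fun n => ?_⟩
  have h1 := (hr n).trans (pow_le_pow_left₀ hr0 (le_max_left r s) n)
  have h2 := (hs n).trans (pow_le_pow_left₀ hs0 (le_max_right r s) n)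
  rw [two_mul]
  refine le_trans ?_ (add_le_add h1 h2)
  rw [← Finset.sum_add_distrib]
  refine Finset.sum_le_sum fun y _ => ?_
  rw [← mul_add]
  refine mul_le_mul_of_nonneg_left ?_ (Finset.prod_nonneg fun t _ => hw _)
  simp only [Finset.sum_sub_distrib, Finset.sum_add_distrib, Finset.sum_neg_distrib,
    Finset.sum_const, Finset.card_univ, Fintype.card_fin, nsmul_eq_mul]
  by_cases h : y ∈ typicalSet w δ n
  · rw [if_neg (not_not.2 h)]
    split_ifs <;> norm_num
  · rw [if_pos h]
    have h' : n * δ ≤ |∑ t, Real.log (w (y t)) + n * H| :=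
      not_lt.1 fun hlt => h (Finset.mem_filter.2 ⟨Finset.mem_univ _, hlt⟩)
    rcases le_abs'.1 h' with h3 | h3
    · rw [if_pos (show 0 ≤ -(∑ t, Real.log (w (y t)) + n * H) - n * δ by linarith)]
      split_ifs <;> norm_num
    · rw [if_pos (show 0 ≤ ∑ t, Real.log (w (y t)) + n * H - n * δ by linarith)]
      split_ifs <;> norm_num

lemma abs_sum_log_add_lt_of_mem {w : Bool → ℝ} {δ : ℝ} {n : ℕ} {y : Fin n → Bool}
    (hy : y ∈ typicalSet w δ n) :
    |∑ t, Real.log (w (y t)) + n * ∑ b, Real.negMulLog (w b)| < n * δ :=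
  (Finset.mem_filter.1 hy).2

lemma prod_eq_exp_sum_log {w : Bool → ℝ} (hw : ∀ b, 0 < w b) {n : ℕ} (y : Fin n → Bool) :
    ∏ t, w (y t) = Real.exp (∑ t, Real.log (w (y t))) := by
  rw [Real.exp_sum]
  exact Finset.prod_congr rfl fun t _ => (Real.exp_log (hw _)).symm

lemma sum_prod_pow {w : Bool → ℝ} (hw1 : ∑ b, w b = 1) (n : ℕ) :
    ∑ y : Fin n → Bool, ∏ t, w (y t) = 1 := by
  rw [← Fintype.prod_sum (fun (_ : Fin n) b => w b)]
  simp only [hw1, Finset.prod_const_one]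

lemma card_typicalSet_le {w : Bool → ℝ} (hw : ∀ b, 0 < w b) (hw1 : ∑ b, w b = 1) (δ : ℝ) (n : ℕ) :
    ((typicalSet w δ n).card : ℝ) ≤ Real.exp (n * (∑ b, Real.negMulLog (w b) + δ)) := by
  have h1 : ∑ y ∈ typicalSet w δ n, ∏ t, w (y t) ≤ 1 := by
    rw [← sum_prod_pow hw1 n]
    exact Finset.sum_le_univ_sum_of_nonneg fun y => Finset.prod_nonneg fun t _ => (hw _).le
  have h2 : ((typicalSet w δ n).card : ℝ) * Real.exp (-(n * (∑ b, Real.negMulLog (w b) + δ)))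
      ≤ ∑ y ∈ typicalSet w δ n, ∏ t, w (y t) := by
    rw [← nsmul_eq_mul]
    refine Finset.card_nsmul_le_sum _ _ _ fun y hy => ?_
    rw [prod_eq_exp_sum_log hw]
    refine Real.exp_le_exp.2 ?_
    have := (abs_lt.1 (abs_sum_log_add_lt_of_mem hy)).1
    linarith
  have h3 := h2.trans h1
  rwa [Real.exp_neg, ← div_eq_mul_inv, div_le_one (Real.exp_pos _)] at h3

lemma le_card_typicalSet {w : Bool → ℝ} (hw : ∀ b, 0 < w b) (hw1 : ∑ b, w b = 1) {δ : ℝ}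
    (hδ : 0 < δ) : ∀ᶠ n : ℕ in Filter.atTop,
      1 / 2 * Real.exp (n * (∑ b, Real.negMulLog (w b) - δ)) ≤ (typicalSet w δ n).card := by
  obtain ⟨r, hr0, hr1, hr⟩ := exists_sum_not_mem_typicalSet_le (fun b => (hw b).le) hw1 hδ
  have hlim := (tendsto_pow_atTop_nhds_zero_of_lt_one hr0 hr1).eventually
    (gt_mem_nhds (show (0 : ℝ) < 1 / 4 by norm_num))
  filter_upwards [hlim] with n hn
  have h1 : 1 / 2 ≤ ∑ y ∈ typicalSet w δ n, ∏ t, w (y t) := by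
    have h := hr n
    have e : ∑ y : Fin n → Bool, (∏ t, w (y t)) * (if y ∉ typicalSet w δ n then 1 else 0)
        = 1 - ∑ y ∈ typicalSet w δ n, ∏ t, w (y t) := by
      refine eq_sub_of_add_eq (Eq.trans ?_ (sum_prod_pow hw1 n))
      rw [← Finset.sum_filter_add_sum_filter_not
        Finset.univ (fun y => y ∉ typicalSet w δ n) (fun y => ∏ t, w (y t)), Finset.sum_filter]
      congr 1
      · exact Finset.sum_congr rfl fun y _ => by split_ifs <;> simp
      · refine Finset.sum_congr ?_ fun _ _ => rfl
        ext y; simp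
    linarith
  have h2 : ∑ y ∈ typicalSet w δ n, ∏ t, w (y t)
      ≤ ((typicalSet w δ n).card : ℝ) * Real.exp (-(n * (∑ b, Real.negMulLog (w b) - δ))) := by
    rw [← nsmul_eq_mul]
    refine Finset.sum_le_card_nsmul _ _ _ fun y hy => ?_
    rw [prod_eq_exp_sum_log hw]
    refine Real.exp_le_exp.2 ?_
    have := (abs_lt.1 (abs_sum_log_add_lt_of_mem hy)).2
    linarith
  have h3 := h1.trans h2
  rwa [Real.exp_neg, ← div_eq_mul_inv, le_div_iff₀ (Real.exp_pos _)] at h3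

lemma exists_forall_bins {α ι : Type*} [Fintype α] [DecidableEq α] (S : Finset ι)
    (A : ι → Finset α) {M : ℕ} (hM : 0 < M) {D : ℝ} (hD : ∀ s ∈ S, D ≤ (A s).card)
    (h : (S.card : ℝ) * (M * Real.exp (-(D / M))) < 1) :
    ∃ b : α → Fin M, ∀ s ∈ S, ∀ m, ∃ a ∈ A s, b a = m := by
  by_contra! hc
  have hM0 : (0 : ℝ) < M := by exact_mod_cast hM
  have hM1 : (1 : ℝ) ≤ M := by exact_mod_cast hM
  set W : (α → Fin M) → ℝ := fun _ => ∏ _a : α, (M : ℝ)⁻¹ with hW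
  have hW0 : ∀ b, 0 ≤ W b := fun b => Finset.prod_nonneg fun _ _ => by positivity
  have h1 : ∑ b, W b = 1 := by
    rw [hW, ← Fintype.prod_sum (fun (_ : α) (_ : Fin M) => (M : ℝ)⁻¹)]
    simp [hM0.ne']
  have h2 : ∀ s ∈ S, ∀ m, ∑ b, (W b * if ∀ a ∈ A s, b a ≠ m then 1 else 0)
      ≤ Real.exp (-(D / M)) := by
    intro s hs m
    have e1 : ∀ b : α → Fin M, (W b * if ∀ a ∈ A s, b a ≠ m then 1 else 0)
        = ∏ a, (if a ∈ A s ∧ b a = m then 0 else (M : ℝ)⁻¹) := by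
      intro b
      split_ifs with hb
      · rw [mul_one]
        exact Finset.prod_congr rfl fun a _ => (if_neg fun h => hb a h.1 h.2).symm
      · push Not at hb
        obtain ⟨a, ha, hba⟩ := hb
        rw [mul_zero]
        have h0 : (if a ∈ A s ∧ b a = m then 0 else (M : ℝ)⁻¹) = 0 := if_pos ⟨ha, hba⟩
        exact (Finset.prod_eq_zero (Finset.mem_univ a) h0).symm
    have e2 : ∀ a : α, ∑ c : Fin M, (if a ∈ A s ∧ c = m then 0 else (M : ℝ)⁻¹)
        = if a ∈ A s then 1 - (M : ℝ)⁻¹ else 1 := by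
      intro a
      have e3 : ∑ _c : Fin M, (M : ℝ)⁻¹ = 1 := by simp [hM0.ne']
      split_ifs with ha
      · have : ∀ c : Fin M, (if a ∈ A s ∧ c = m then 0 else (M : ℝ)⁻¹)
            = (M : ℝ)⁻¹ - if c = m then (M : ℝ)⁻¹ else 0 := by
          intro c; by_cases hcm : c = m <;> simp [ha, hcm]
        simp only [this, Finset.sum_sub_distrib, e3]
        simp
      · simp only [ha, false_and, if_false, e3]
    simp only [e1]
    rw [← Fintype.prod_sum (fun a (c : Fin M) => if a ∈ A s ∧ c = m then 0 else (M : ℝ)⁻¹)]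
    simp only [e2]
    rw [Finset.prod_ite, Finset.prod_const, Finset.prod_const_one, mul_one,
      show (Finset.univ.filter fun a => a ∈ A s) = A s by ext; simp]
    have h3 : 1 - (M : ℝ)⁻¹ ≤ Real.exp (-(M : ℝ)⁻¹) := by
      have := Real.add_one_le_exp (-(M : ℝ)⁻¹)
      linarith
    refine (pow_le_pow_left₀ (sub_nonneg.2 (inv_le_one_of_one_le₀ hM1)) h3 _).trans ?_
    rw [← Real.exp_nat_mul]
    refine Real.exp_le_exp.2 ?_
    rw [mul_neg, neg_le_neg_iff, ← div_eq_mul_inv]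
    gcongr
    exact hD s hs
  have h3 : ∀ b, W b ≤ ∑ s ∈ S, ∑ m, (W b * if ∀ a ∈ A s, b a ≠ m then 1 else 0) := by
    intro b
    obtain ⟨s, hs, m, hsm⟩ := hc b
    have hnn : ∀ s m, 0 ≤ (W b * if ∀ a ∈ A s, b a ≠ m then 1 else 0) := fun s m =>
      mul_nonneg (hW0 b) (by split_ifs <;> norm_num)
    calc W b = W b * if ∀ a ∈ A s, b a ≠ m then 1 else 0 := by rw [if_pos hsm, mul_one]
      _ ≤ ∑ m, (W b * if ∀ a ∈ A s, b a ≠ m then 1 else 0) :=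
        Finset.single_le_sum (f := fun m => W b * if ∀ a ∈ A s, b a ≠ m then 1 else 0)
          (fun m _ => hnn s m) (Finset.mem_univ m)
      _ ≤ _ := Finset.single_le_sum
          (f := fun s => ∑ m, (W b * if ∀ a ∈ A s, b a ≠ m then 1 else 0))
          (fun s _ => Finset.sum_nonneg fun m _ => hnn s m) hs
  have h4 := Finset.sum_le_sum fun b (_ : b ∈ Finset.univ) => h3 b
  rw [h1, Finset.sum_comm] at h4
  have h5 : ∑ s ∈ S, ∑ b, ∑ m, (W b * if ∀ a ∈ A s, b a ≠ m then 1 else 0)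
      ≤ ∑ _s ∈ S, (M * Real.exp (-(D / M))) := by
    refine Finset.sum_le_sum fun s hs => ?_
    rw [Finset.sum_comm]
    refine (Finset.sum_le_sum fun m _ => h2 s hs m).trans (le_of_eq ?_)
    simp
  rw [Finset.sum_const, nsmul_eq_mul] at h5
  linarith

/-- The `Bern(2/3)` law of the first output letter under the uniform input. -/
def bernTwoThirds (b : Bool) : ℝ := if b then 2 / 3 else 1 / 3

lemma sum_negMulLog_bernTwoThirds :
    ∑ b, Real.negMulLog (bernTwoThirds b) = Real.log 3 - 2 / 3 * Real.log 2 := by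
  simp [bernTwoThirds, Real.negMulLog, Real.log_div]
  ring

lemma log_bernTwoThirds (b : Bool) :
    Real.log (bernTwoThirds b) = (if b then Real.log 2 else 0) - Real.log 3 := by
  cases b <;> simp [bernTwoThirds, Real.log_div]

/-- Binary blocks dominated by `S`. -/
def dominated {k : ℕ} (S : Fin k → Bool) : Finset (Fin k → Bool) :=
  Fintype.piFinset fun t => if S t then Finset.univ else {false}

lemma card_dominated {k : ℕ} (S : Fin k → Bool) :
    ((dominated S).card : ℝ) = Real.exp (∑ t, if S t then Real.log 2 else 0) := by
  rw [dominated, Fintype.card_piFinset, Real.exp_sum, Nat.cast_prod]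
  refine Finset.prod_congr rfl fun t _ => ?_
  split_ifs
  · rw [Real.exp_log (by norm_num)]; simp
  · simp

lemma exp_le_card_dominated {k : ℕ} {S : Fin k → Bool} {δ : ℝ}
    (hS : S ∈ typicalSet bernTwoThirds δ k) :
    Real.exp (k * (2 / 3 * Real.log 2 - δ)) ≤ (dominated S).card := by
  rw [card_dominated]
  refine Real.exp_le_exp.2 ?_
  have h := (abs_lt.1 (abs_sum_log_add_lt_of_mem hS)).1
  simp only [log_bernTwoThirds, sum_negMulLog_bernTwoThirds, Finset.sum_sub_distrib,
    Finset.sum_const, Finset.card_univ, Fintype.card_fin, nsmul_eq_mul] at h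
  linarith

/-- Input letter with first noiseless output `s` and second noiseless output `s'`. -/
def blackwellIn (s s' : Bool) : Fin 3 := if s' then 2 else if s then 1 else 0

lemma letter2_blackwellIn (s s' : Bool) : letter2 (blackwellIn s s') = s' := by
  revert s s'; decide

lemma letter1_blackwellIn {s s' : Bool} (h : s' = true → s = true) :
    letter1 (blackwellIn s s') = s := by
  revert s s'; decide

/-- Zero-error codes for the noiseless Blackwell channel. -/
lemma exists_noiseless_code {δ : ℝ} (hδ : 0 < δ) : ∀ᶠ k : ℕ in Filter.atTop, ∀ M1 M2 : ℕ,
    0 < M1 → 0 < M2 →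
    (M1 : ℝ) ≤ 1 / 2 * Real.exp (k * (Real.log 3 - 2 / 3 * Real.log 2 - δ)) →
    (M2 : ℝ) ≤ Real.exp (k * (2 / 3 * Real.log 2 - 2 * δ)) →
    ∃ (x : Fin M1 → Fin M2 → Fin k → Fin 3) (d1 : (Fin k → Bool) → Fin M1)
      (d2 : (Fin k → Bool) → Fin M2), ∀ m1 m2,
        d1 (fun t => letter1 (x m1 m2 t)) = m1 ∧ d2 (fun t => letter2 (x m1 m2 t)) = m2 := by
  have hw : ∀ b, 0 < bernTwoThirds b := fun b => by cases b <;> norm_num [bernTwoThirds]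
  have hw1 : ∑ b, bernTwoThirds b = 1 := by norm_num [bernTwoThirds]
  have hl2 : 0 < Real.log 2 := Real.log_pos (by norm_num)
  have hlim : ∀ᶠ k : ℕ in Filter.atTop, (k : ℝ) * (2 * Real.log 2) < Real.exp (k * δ) := by
    have h := (Real.tendsto_exp_div_pow_atTop 1).comp
      ((tendsto_natCast_atTop_atTop (R := ℝ)).atTop_mul_const hδ)
    filter_upwards [h.eventually_gt_atTop (2 * Real.log 2 / δ), Filter.eventually_gt_atTop 0]
      with k hk hk0
    have hk0' : (0 : ℝ) < k := by exact_mod_cast hk0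
    simp only [Function.comp, pow_one] at hk
    rw [div_lt_div_iff₀ hδ (by positivity)] at hk
    have : (k : ℝ) * (2 * Real.log 2) * δ < Real.exp (k * δ) * δ := by linarith
    exact lt_of_mul_lt_mul_right this hδ.le
  filter_upwards [le_card_typicalSet hw hw1 hδ, hlim] with k hk hk2 M1 M2 p1 p2 h1 h2
  have p1' : (0 : ℝ) < M1 := by exact_mod_cast p1
  have p2' : (0 : ℝ) < M2 := by exact_mod_cast p2
  rw [sum_negMulLog_bernTwoThirds] at hk
  set S := typicalSet bernTwoThirds δ k with hS
  have hcard : (S.card : ℝ) ≤ Real.exp (k * Real.log 2) := by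
    have : S.card ≤ 2 ^ k := (Finset.card_le_univ S).trans (by simp)
    rw [Real.exp_nat_mul, Real.exp_log (by norm_num)]
    exact_mod_cast this
  have hM2 : (M2 : ℝ) ≤ Real.exp (k * Real.log 2) := by
    refine h2.trans (Real.exp_le_exp.2 (mul_le_mul_of_nonneg_left ?_ (by positivity)))
    linarith
  obtain ⟨b, hb⟩ := exists_forall_bins S dominated p2
    (D := Real.exp (k * (2 / 3 * Real.log 2 - δ))) (fun s hs => exp_le_card_dominated hs) (by
      have e : Real.exp (k * δ) ≤ Real.exp (k * (2 / 3 * Real.log 2 - δ)) / M2 := by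
        rw [le_div_iff₀ p2']
        refine (mul_le_mul_of_nonneg_left h2 (Real.exp_pos _).le).trans (le_of_eq ?_)
        rw [← Real.exp_add]; congr 1; ring
      have e2 := Real.exp_le_exp.2 (neg_le_neg e)
      calc (S.card : ℝ) * (M2 * Real.exp (-(Real.exp (k * (2 / 3 * Real.log 2 - δ)) / M2)))
          ≤ Real.exp (k * Real.log 2) * (Real.exp (k * Real.log 2)
            * Real.exp (-Real.exp (k * δ))) := by gcongr
        _ = Real.exp (k * (2 * Real.log 2) - Real.exp (k * δ)) := by
          rw [← Real.exp_add, ← Real.exp_add]; congr 1; ring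
        _ < 1 := by rw [Real.exp_lt_one_iff]; linarith)
  have hM1 : Fintype.card (Fin M1) ≤ Fintype.card S := by
    rw [Fintype.card_fin, Fintype.card_coe]
    exact_mod_cast h1.trans hk
  obtain ⟨c⟩ := Function.Embedding.nonempty_of_card_le hM1
  have : Nonempty (Fin M1) := ⟨⟨0, p1⟩⟩
  choose T hT1 hT2 using fun m1 => hb (c m1) (c m1).2
  have hdom : ∀ m1 m2 t, T m1 m2 t = true → (c m1 : Fin k → Bool) t = true := by
    intro m1 m2 t h
    have := Fintype.mem_piFinset.1 (hT1 m1 m2) t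
    by_contra hc
    rw [if_neg hc, Finset.mem_singleton, h] at this
    exact Bool.noConfusion this
  refine ⟨fun m1 m2 t => blackwellIn ((c m1 : Fin k → Bool) t) (T m1 m2 t),
    Function.invFun fun m1 => (c m1 : Fin k → Bool), b, fun m1 m2 => ⟨?_, ?_⟩⟩
  · simp only [letter1_blackwellIn (hdom m1 m2 _)]
    exact Function.leftInverse_invFun (fun a b h => c.injective (Subtype.ext h)) m1
  · simp only [letter2_blackwellIn]
    exact hT2 m1 m2

/-- Two distinct points collide under a uniformly random map with probability `2⁻ᵏ`, also after
adding fixed masks. -/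
lemma two_pow_mul_sum_collision {α ι : Type*} [Fintype α] [Fintype ι] {a a' : α} (h : a' ≠ a)
    (v v' : ι → Bool) :
    (2 : ℝ) ^ Fintype.card ι * ∑ C : α → ι → Bool,
      (if (fun j => Bool.xor (C a' j) (v' j)) = (fun j => Bool.xor (C a j) (v j)) then (1 : ℝ)
        else 0) = Fintype.card (α → ι → Bool) := by
  have hc := card_mul_sum_eq_sum_update (β := ι → Bool) a' fun C : α → ι → Bool =>
    if (fun j => Bool.xor (C a' j) (v' j)) = (fun j => Bool.xor (C a j) (v j)) then (1 : ℝ) else 0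
  have e : (Fintype.card (ι → Bool) : ℝ) = 2 ^ Fintype.card ι := by simp
  rw [← e, hc]
  have h1 : ∀ C : α → ι → Bool, (∑ b : ι → Bool,
      if (fun j => Bool.xor (Function.update C a' b a' j) (v' j))
        = (fun j => Bool.xor (Function.update C a' b a j) (v j)) then (1 : ℝ) else 0) = 1 := by
    intro C
    have h2 : ∀ b : ι → Bool, ((fun j => Bool.xor (Function.update C a' b a' j) (v' j))
        = (fun j => Bool.xor (Function.update C a' b a j) (v j)))
        ↔ b = fun j => Bool.xor (Bool.xor (C a j) (v j)) (v' j) := by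
      intro b
      rw [Function.update_self, Function.update_of_ne h.symm, funext_iff, funext_iff]
      refine forall_congr' fun j => ?_
      cases b j <;> cases v' j <;> cases C a j <;> cases v j <;> decide
    simp only [h2]
    rw [Finset.sum_ite_eq' Finset.univ, if_pos (Finset.mem_univ _)]
  simp only [h1, Finset.sum_const, nsmul_eq_mul, mul_one, Finset.card_univ]

/-- Random hashing: a label `C (a ω)` masked by `v ω` identifies `a ω` for most `ω`. -/
lemma exists_hash_decoder {Ω α ι : Type*} [Fintype Ω] [Fintype α] [Nonempty α] [Fintype ι]
    {P : Ω → ℝ} (hP : ∀ ω, 0 ≤ P ω) (hP1 : ∑ ω, P ω = 1) (a : Ω → α) (v : Ω → ι → Bool)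
    (B : Finset Ω) :
    ∃ (C : α → ι → Bool) (D : (ι → Bool) → α),
      ∑ ω, P ω * (if D (fun j => Bool.xor (C (a ω) j) (v ω j)) ≠ a ω then 1 else 0)
        ≤ ∑ ω, P ω * (if ω ∉ B then 1 else 0) + B.card / 2 ^ Fintype.card ι := by
  set s : (α → ι → Bool) → Ω → ι → Bool := fun C ω j => Bool.xor (C (a ω) j) (v ω j) with hs
  have hD : ∀ C, ∃ D : (ι → Bool) → α, ∀ ω, D (s C ω) ≠ a ω →
      ω ∉ B ∨ ∃ ω' ∈ B, a ω' ≠ a ω ∧ s C ω' = s C ω := by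
    intro C
    have : ∀ u, ∃ x : α, (∃ ω ∈ B, s C ω = u) → ∃ ω ∈ B, s C ω = u ∧ a ω = x := by
      intro u
      by_cases h : ∃ ω ∈ B, s C ω = u
      · obtain ⟨ω, h1, h2⟩ := h
        exact ⟨a ω, fun _ => ⟨ω, h1, h2, rfl⟩⟩
      · exact ⟨Classical.arbitrary α, fun h' => absurd h' h⟩
    choose D hD using this
    refine ⟨D, fun ω hω => or_iff_not_imp_left.2 fun hB => ?_⟩
    obtain ⟨ω', h1, h2, h3⟩ := hD (s C ω) ⟨ω, not_not.1 hB, rfl⟩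
    exact ⟨ω', h1, h3 ▸ hω, h2⟩
  choose D hD using hD
  have h1 : ∀ C ω, (if D C (s C ω) ≠ a ω then (1 : ℝ) else 0) ≤ (if ω ∉ B then 1 else 0)
      + ∑ ω' ∈ B, if a ω' ≠ a ω ∧ s C ω' = s C ω then 1 else 0 := by
    intro C ω
    have hnn : ∀ ω' ∈ B, (0 : ℝ) ≤ if a ω' ≠ a ω ∧ s C ω' = s C ω then 1 else 0 :=
      fun _ _ => by split_ifs <;> norm_num
    by_cases h : D C (s C ω) ≠ a ω
    · rw [if_pos h]
      rcases hD C ω h with h2 | ⟨ω', h2, h3⟩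
      · rw [if_pos h2]
        exact le_add_of_nonneg_right (Finset.sum_nonneg hnn)
      · have := Finset.single_le_sum hnn h2
        rw [if_pos h3] at this
        refine this.trans (le_add_of_nonneg_left ?_)
        split_ifs <;> norm_num
    · rw [if_neg h]
      refine add_nonneg ?_ (Finset.sum_nonneg hnn)
      split_ifs <;> norm_num
  have h2 : ∀ ω ω', ∑ C, (if a ω' ≠ a ω ∧ s C ω' = s C ω then (1 : ℝ) else 0)
      ≤ Fintype.card (α → ι → Bool) / 2 ^ Fintype.card ι := by
    intro ω ω'
    by_cases h : a ω' = a ω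
    · simp only [h, ne_eq, not_true_eq_false, false_and, if_false, Finset.sum_const_zero]
      positivity
    · rw [le_div_iff₀' (by positivity), ← two_pow_mul_sum_collision h (v ω) (v ω')]
      simp only [ne_eq, h, not_false_eq_true, true_and, hs]
      exact le_rfl
  obtain ⟨C, -, hC⟩ := Finset.exists_le_of_sum_le (s := (Finset.univ : Finset (α → ι → Bool)))
    (f := fun C => ∑ ω, P ω * (if D C (s C ω) ≠ a ω then 1 else 0))
    (g := fun _ => ∑ ω, P ω * (if ω ∉ B then 1 else 0) + (B.card : ℝ) / 2 ^ Fintype.card ι)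
    ⟨fun _ _ => false, Finset.mem_univ _⟩ (by
      calc ∑ C, ∑ ω, P ω * (if D C (s C ω) ≠ a ω then 1 else 0)
          ≤ ∑ C, ∑ ω, P ω * ((if ω ∉ B then 1 else 0)
            + ∑ ω' ∈ B, if a ω' ≠ a ω ∧ s C ω' = s C ω then 1 else 0) :=
            Finset.sum_le_sum fun C _ => Finset.sum_le_sum fun ω _ =>
              mul_le_mul_of_nonneg_left (h1 C ω) (hP ω)
        _ = ∑ ω, P ω * (Fintype.card (α → ι → Bool) * (if ω ∉ B then 1 else 0)
            + ∑ ω' ∈ B, ∑ C, if a ω' ≠ a ω ∧ s C ω' = s C ω then 1 else 0) := by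
          rw [Finset.sum_comm]
          refine Finset.sum_congr rfl fun ω _ => ?_
          rw [← Finset.mul_sum, Finset.sum_add_distrib, Finset.sum_const, nsmul_eq_mul,
            Finset.card_univ, Finset.sum_comm]
        _ ≤ ∑ ω, P ω * (Fintype.card (α → ι → Bool) * (if ω ∉ B then 1 else 0)
            + ∑ _ω' ∈ B, (Fintype.card (α → ι → Bool) : ℝ) / 2 ^ Fintype.card ι) :=
            Finset.sum_le_sum fun ω _ => mul_le_mul_of_nonneg_left
              (add_le_add_right (Finset.sum_le_sum fun ω' _ => h2 ω ω') _) (hP ω)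
        _ = _ := by
          rw [Finset.sum_const, Finset.sum_const, nsmul_eq_mul, nsmul_eq_mul, Finset.card_univ]
          simp only [mul_add, Finset.sum_add_distrib]
          rw [← Finset.sum_mul, hP1, Finset.mul_sum]
          congr 1
          · exact Finset.sum_congr rfl fun ω _ => by ring
          · ring)
  exact ⟨C, D C, hC⟩

/-- Two-phase input rule: a fixed block, then a function of the outputs during that block. -/
def twoPhaseInput {n1 n2 : ℕ} (x : Fin n1 → Fin 3) (C : (Fin n1 → Bool) → Fin n2 → Bool)
    (t : Fin (n1 + n2)) (z : Fin (n1 + n2) → Bool × Bool) : Fin 3 :=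
  Fin.addCases x (fun j => if C (fun i => Bool.xor (z (Fin.castAdd n2 i)).1 (letter1 (x i))) j
    then 2 else 0) t

lemma causalInput_twoPhaseInput {n1 n2 : ℕ} (x : Fin n1 → Fin 3)
    (C : (Fin n1 → Bool) → Fin n2 → Bool) : CausalInput (twoPhaseInput x C) := by
  intro t
  refine Fin.addCases (fun i z z' _ => ?_) (fun j z z' h => ?_) t
  · simp only [twoPhaseInput, Fin.addCases_left]
  · simp only [twoPhaseInput, Fin.addCases_right]
    have : ∀ i : Fin n1, z (Fin.castAdd n2 i) = z' (Fin.castAdd n2 i) := fun i =>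
      h _ (by simp only [Fin.val_castAdd, Fin.val_natAdd]; omega)
    simp only [this]

lemma letter1_ite_two (b : Bool) : letter1 (if b then 2 else 0) = b := by
  cases b <;> decide

lemma letter2_ite_two (b : Bool) : letter2 (if b then 2 else 0) = b := by
  cases b <;> decide

/-- Noiseless block recovered from the outputs `y` with the decoder `D` for the noise. -/
def twoPhaseEstimate {n1 n2 : ℕ} (D : (Fin n2 → Bool) → Fin n1 → Bool) (y : Fin (n1 + n2) → Bool)
    (i : Fin n1) : Bool :=
  Bool.xor (y (Fin.castAdd n2 i)) (D (fun j => y (Fin.natAdd n1 j)) i)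

/-- Unless the decoder `D` mistakes the noise, both noiseless blocks are recovered. -/
lemma sum_twoPhaseInput_le {p : ℝ} (hp0 : 0 < p) (hp1 : p < 1) {n1 n2 : ℕ} (x : Fin n1 → Fin 3)
    (C : (Fin n1 → Bool) → Fin n2 → Bool) (D : (Fin n2 → Bool) → Fin n1 → Bool)
    {F : (Fin (n1 + n2) → Bool × Bool) → ℝ} (hF1 : ∀ z, F z ≤ 1)
    (hF : ∀ z, twoPhaseEstimate D (fun t => (z t).1) = (fun i => letter1 (x i)) →
      twoPhaseEstimate D (fun t => (z t).2) = (fun i => letter2 (x i)) → F z = 0) :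
    ∑ z, (∏ t, blackwellW p (twoPhaseInput x C t z) (z t)) * F z
      ≤ ∑ ν, bscBlock p (fun _ => false) ν *
        (if D (fun j => Bool.xor (C (fun i => ν (Fin.castAdd n2 i)) j) (ν (Fin.natAdd n1 j)))
          ≠ (fun i => ν (Fin.castAdd n2 i)) then (1 : ℝ) else 0) := by
  obtain ⟨out, hout, hsum⟩ := exists_sum_feedback p (causalInput_twoPhaseInput x C)
  rw [hsum]
  refine Finset.sum_le_sum fun ν _ => mul_le_mul_of_nonneg_left ?_ (bscBlock_pos hp0 hp1 _ ν).le
  by_cases h : D (fun j => Bool.xor (C (fun i => ν (Fin.castAdd n2 i)) j) (ν (Fin.natAdd n1 j)))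
    ≠ (fun i => ν (Fin.castAdd n2 i))
  · rw [if_pos h]
    exact hF1 _
  · rw [if_neg h]
    rw [not_not] at h
    have a1 : ∀ i, out ν (Fin.castAdd n2 i) = blackwellOut (x i) (ν (Fin.castAdd n2 i)) := by
      intro i
      rw [hout, twoPhaseInput, Fin.addCases_left]
    have a2 : (fun i => Bool.xor (out ν (Fin.castAdd n2 i)).1 (letter1 (x i)))
        = fun i => ν (Fin.castAdd n2 i) := by
      funext i
      rw [a1, blackwellOut]
      cases letter1 (x i) <;> cases ν (Fin.castAdd n2 i) <;> rfl
    have a3 : ∀ j, out ν (Fin.natAdd n1 j)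
        = (Bool.xor (C (fun i => ν (Fin.castAdd n2 i)) j) (ν (Fin.natAdd n1 j)),
          Bool.xor (C (fun i => ν (Fin.castAdd n2 i)) j) (ν (Fin.natAdd n1 j))) := by
      intro j
      rw [hout, twoPhaseInput, Fin.addCases_right, a2, blackwellOut, letter1_ite_two,
        letter2_ite_two]
    refine (hF _ ?_ ?_).le
    · funext i
      simp only [twoPhaseEstimate, a3, a1, h, blackwellOut]
      cases letter1 (x i) <;> cases ν (Fin.castAdd n2 i) <;> rfl
    · funext i
      simp only [twoPhaseEstimate, a3, a1, h, blackwellOut]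
      cases letter2 (x i) <;> cases ν (Fin.castAdd n2 i) <;> rfl

/-- Resend feedback scheme: an uncoded-noise phase carrying a zero-error code for the noiseless
channel, followed by a phase that describes the noise of the first phase to both receivers. -/
lemma exists_feedback_code {p : ℝ} (hp0 : 0 < p) (hp1 : p < 1) {n1 n2 : ℕ} {R1 R2 : ℝ}
    (hR1 : 0 ≤ R1) (hR2 : 0 ≤ R2)
    {x : Fin (msgCard (n1 + n2) R1) → Fin (msgCard (n1 + n2) R2) → Fin n1 → Fin 3}
    {d1 : (Fin n1 → Bool) → Fin (msgCard (n1 + n2) R1)}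
    {d2 : (Fin n1 → Bool) → Fin (msgCard (n1 + n2) R2)}
    (hd : ∀ m1 m2, d1 (fun t => letter1 (x m1 m2 t)) = m1 ∧
      d2 (fun t => letter2 (x m1 m2 t)) = m2) (B : Finset (Fin (n1 + n2) → Bool)) :
    ∃ enc dec1 dec2, Causal (n1 + n2) enc ∧
      errProbFB (noiselessExt (blackwellW p)) (n1 + n2) 0 R1 R2 enc dec1 dec2
        ≤ ∑ ν, bscBlock p (fun _ => false) ν * (if ν ∉ B then 1 else 0)
          + B.card / 2 ^ n2 := by
  obtain ⟨C, D, hCD⟩ := exists_hash_decoder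
    (fun ν => (bscBlock_pos hp0 hp1 (fun _ => false) ν).le)
    (sum_bscBlock (p := p) (fun _ : Fin (n1 + n2) => false))
    (fun ν i => ν (Fin.castAdd n2 i)) (fun ν j => ν (Fin.natAdd n1 j)) B
  rw [Fintype.card_fin] at hCD
  have hCD' : ∑ ν, bscBlock p (fun _ => false) ν *
      (if D (fun j => Bool.xor (C (fun i => ν (Fin.castAdd n2 i)) j) (ν (Fin.natAdd n1 j)))
        ≠ (fun i => ν (Fin.castAdd n2 i)) then (1 : ℝ) else 0)
      ≤ ∑ ν, bscBlock p (fun _ => false) ν * (if ν ∉ B then 1 else 0) + B.card / 2 ^ n2 := by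
    convert hCD
  have h0 : 0 < msgCard (n1 + n2) 0 := msgCard_pos le_rfl
  have hN1 : 0 < msgCard (n1 + n2) R1 := msgCard_pos hR1
  have hN2 : 0 < msgCard (n1 + n2) R2 := msgCard_pos hR2
  have hsub : ∀ i j : Fin (msgCard (n1 + n2) 0), i = j := by
    rw [msgCard_zero]
    exact fun i j => Subsingleton.elim i j
  refine ⟨fun t m z => twoPhaseInput (x m.2.1 m.2.2) C t z,
    fun y => (⟨0, h0⟩, d1 (twoPhaseEstimate D y)), fun y => (⟨0, h0⟩, d2 (twoPhaseEstimate D y)),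
    fun t m z z' h => causalInput_twoPhaseInput _ C t z z' h, ?_⟩
  refine le_trans ?_ hCD'
  rw [errProbFB_noiselessExt]
  have hpos : (0 : ℝ) < (msgCard (n1 + n2) 0 : ℝ) * msgCard (n1 + n2) R1 * msgCard (n1 + n2) R2 :=
    mul_pos (mul_pos (Nat.cast_pos.2 h0) (Nat.cast_pos.2 hN1)) (Nat.cast_pos.2 hN2)
  rw [one_div, inv_mul_le_iff₀ hpos]
  refine (Finset.sum_le_sum fun m _ => sum_twoPhaseInput_le hp0 hp1 (x m.2.1 m.2.2) C D
    (fun z => ?_) fun z h1 h2 => ?_).trans (le_of_eq ?_)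
  · split_ifs <;> norm_num
  · rw [h1, h2, (hd _ _).1, (hd _ _).2, hsub ⟨0, h0⟩ m.1]
    exact if_neg (by simp)
  · rw [Finset.sum_const, nsmul_eq_mul, Finset.card_univ, Fintype.card_prod, Fintype.card_prod,
      Fintype.card_fin, Fintype.card_fin, Fintype.card_fin, Nat.cast_mul, Nat.cast_mul]
    simp only [mul_assoc]

lemma errProbFB_noiselessExt_nonneg {p : ℝ} (hp0 : 0 < p) (hp1 : p < 1) {n : ℕ} {R0 R1 R2 : ℝ}
    (enc : Fin n → Fin (msgCard n R0) × Fin (msgCard n R1) × Fin (msgCard n R2) →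
      (Fin n → Bool × Bool) → Fin 3)
    (dec1 : (Fin n → Bool) → Fin (msgCard n R0) × Fin (msgCard n R1))
    (dec2 : (Fin n → Bool) → Fin (msgCard n R0) × Fin (msgCard n R2)) :
    0 ≤ errProbFB (noiselessExt (blackwellW p)) n R0 R1 R2 enc dec1 dec2 := by
  rw [errProbFB_noiselessExt]
  refine mul_nonneg (by positivity) (Finset.sum_nonneg fun m _ => Finset.sum_nonneg fun z _ =>
    mul_nonneg (Finset.prod_nonneg fun t _ => blackwellW_nonneg hp0 hp1 _ _) ?_)
  split_ifs <;> norm_num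

lemma sum_negMulLog_bsc (p : ℝ) : ∑ b, Real.negMulLog (bsc p false b) = Real.binEntropy p := by
  rw [Real.binEntropy_eq_negMulLog_add_negMulLog_one_sub]
  simp [bsc, Fintype.univ_bool]

lemma msgCard_le_exp (n : ℕ) (R : ℝ) :
    (msgCard n R : ℝ) ≤ Real.exp (n * (R * Real.log 2)) := by
  refine msgCard_le.trans (le_of_eq ?_)
  rw [Real.rpow_def_of_pos (by norm_num)]
  congr 1
  ring

lemma eventually_exists_feedback_code {p : ℝ} (hp0 : 0 < p) (hp1 : p < 1) {R1 R2 α : ℝ}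
    (hR1 : 0 ≤ R1) (hR2 : 0 ≤ R2) (hα : 0 < α)
    (hαp : α * Real.log 2 < Real.log 2 - Real.binEntropy p)
    (h1 : R1 * Real.log 2 < α * (Real.log 3 - 2 / 3 * Real.log 2))
    (h2 : R2 * Real.log 2 < α * (2 / 3 * Real.log 2)) :
    ∃ b : ℕ → ℝ, Filter.Tendsto b Filter.atTop (nhds 0) ∧ ∀ᶠ n in Filter.atTop,
      ∃ enc dec1 dec2, Causal n enc ∧
        errProbFB (noiselessExt (blackwellW p)) n 0 R1 R2 enc dec1 dec2 ≤ b n := by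
  have hl2 : 0 < Real.log 2 := Real.log_pos (by norm_num)
  have hα1 : α < 1 := by
    have := Real.binEntropy_nonneg hp0.le hp1.le
    have h : α * Real.log 2 < 1 * Real.log 2 := by linarith
    exact lt_of_mul_lt_mul_right h hl2.le
  obtain ⟨δ, hδ, hδ'⟩ := exists_between (lt_min (lt_min
    (show 0 < Real.log 2 - Real.binEntropy p - α * Real.log 2 by linarith)
    (show 0 < (α * (Real.log 3 - 2 / 3 * Real.log 2) - R1 * Real.log 2) / α from
      div_pos (by linarith) hα))
    (show 0 < (α * (2 / 3 * Real.log 2) - R2 * Real.log 2) / (2 * α) from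
      div_pos (by linarith) (by linarith)))
  rw [lt_min_iff, lt_min_iff, lt_div_iff₀ hα, lt_div_iff₀ (by linarith)] at hδ'
  obtain ⟨⟨d0, d1⟩, d2⟩ := hδ'
  set A1 := Real.log 3 - 2 / 3 * Real.log 2 - δ with hA1
  set A2 := 2 / 3 * Real.log 2 - 2 * δ with hA2
  have c1 : 0 < α * A1 - R1 * Real.log 2 := by rw [hA1]; linarith
  have c2 : 0 < α * A2 - R2 * Real.log 2 := by rw [hA2]; linarith
  have hA1' : 0 < A1 := by
    have : 0 < α * A1 := by nlinarith [mul_nonneg hR1 hl2.le]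
    exact pos_of_mul_pos_right this hα.le
  have hA2' : 0 < A2 := by
    have : 0 < α * A2 := by nlinarith [mul_nonneg hR2 hl2.le]
    exact pos_of_mul_pos_right this hα.le
  have hb : ∀ b, 0 < bsc p false b := fun b => bsc_pos hp0 hp1 _ _
  obtain ⟨r, hr0, hr1, hr⟩ :=
    exists_sum_not_mem_typicalSet_le (fun b => (hb b).le) (sum_bsc false) hδ
  set κ := (1 - α) * Real.log 2 - Real.binEntropy p - δ with hκ
  have hκ0 : 0 < κ := by rw [hκ]; linarith
  refine ⟨fun n => 2 * r ^ n + Real.exp (-κ) ^ n, ?_, ?_⟩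
  · have t1 := (tendsto_pow_atTop_nhds_zero_of_lt_one hr0 hr1).const_mul 2
    have t2 := tendsto_pow_atTop_nhds_zero_of_lt_one (Real.exp_pos (-κ)).le
      (Real.exp_lt_one_iff.2 (neg_neg_of_pos hκ0))
    simpa using t1.add t2
  have hN : Filter.Tendsto (fun n : ℕ => (n : ℝ)) Filter.atTop Filter.atTop :=
    tendsto_natCast_atTop_atTop
  have hfloor : Filter.Tendsto (fun n : ℕ => ⌊α * n⌋₊) Filter.atTop Filter.atTop :=
    tendsto_nat_floor_atTop.comp (hN.const_mul_atTop hα)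
  filter_upwards [hfloor.eventually (exists_noiseless_code hδ),
    (hN.const_mul_atTop c1).eventually_ge_atTop (A1 + Real.log 2),
    (hN.const_mul_atTop c2).eventually_ge_atTop A2] with n hcode e1 e2
  obtain ⟨k, hk⟩ : ∃ k, k = ⌊α * n⌋₊ := ⟨_, rfl⟩
  rw [← hk, ← hA1, ← hA2] at hcode
  have hn0 : (0 : ℝ) ≤ n := Nat.cast_nonneg n
  have hk1 : (k : ℝ) ≤ α * n := by rw [hk]; exact Nat.floor_le (by positivity)
  have hk2 : α * n - 1 ≤ k := by rw [hk]; exact (Nat.sub_one_lt_floor _).le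
  have hkn : k ≤ n := by
    have : (k : ℝ) ≤ n := hk1.trans (by nlinarith)
    exact_mod_cast this
  obtain ⟨x, d1, d2, hd⟩ := hcode (msgCard n R1) (msgCard n R2) (msgCard_pos hR1)
    (msgCard_pos hR2) (by
      refine (msgCard_le_exp n R1).trans ?_
      have : (1 / 2 : ℝ) = Real.exp (-Real.log 2) := by
        rw [Real.exp_neg, Real.exp_log (by norm_num), one_div]
      rw [this, ← Real.exp_add]
      refine Real.exp_le_exp.2 ?_
      have := mul_le_mul_of_nonneg_right hk2 hA1'.le
      linarith) (by
      refine (msgCard_le_exp n R2).trans (Real.exp_le_exp.2 ?_)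
      have := mul_le_mul_of_nonneg_right hk2 hA2'.le
      linarith)
  clear hk
  obtain ⟨n2, rfl⟩ := Nat.exists_eq_add_of_le hkn
  obtain ⟨enc, dec1, dec2, hcausal, herr⟩ := exists_feedback_code hp0 hp1 hR1 hR2 hd
    (typicalSet (bsc p false) δ (k + n2))
  refine ⟨enc, dec1, dec2, hcausal, herr.trans (add_le_add (hr (k + n2)) ?_)⟩
  rw [div_le_iff₀ (by positivity)]
  refine (card_typicalSet_le hb (sum_bsc false) δ (k + n2)).trans ?_
  have e3 : (2 : ℝ) ^ n2 = Real.exp (n2 * Real.log 2) := by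
    rw [Real.exp_nat_mul, Real.exp_log (by norm_num)]
  rw [e3, ← Real.exp_nat_mul, ← Real.exp_add, sum_negMulLog_bsc]
  refine Real.exp_le_exp.2 ?_
  have e4 : (k : ℝ) * Real.log 2 ≤ α * (k + n2 : ℕ) * Real.log 2 :=
    mul_le_mul_of_nonneg_right hk1 hl2.le
  rw [hκ]
  push_cast at e4 ⊢
  nlinarith

/-- Rate pairs achieved by the resend feedback scheme. -/
lemma achievableFB_blackwell {p : ℝ} (hp0 : 0 < p) (hp1 : p < 1) {R1 R2 α : ℝ}
    (hR1 : 0 ≤ R1) (hR2 : 0 ≤ R2) (hα : 0 < α)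
    (hαp : α * Real.log 2 < Real.log 2 - Real.binEntropy p)
    (h1 : R1 * Real.log 2 < α * (Real.log 3 - 2 / 3 * Real.log 2))
    (h2 : R2 * Real.log 2 < α * (2 / 3 * Real.log 2)) :
    AchievableFB (noiselessExt (blackwellW p)) 0 R1 R2 := by
  obtain ⟨b, hb, hev⟩ := eventually_exists_feedback_code hp0 hp1 hR1 hR2 hα hαp h1 h2
  have : ∀ n, ∃ enc dec1 dec2, Causal n enc ∧
      ((∃ enc dec1 dec2, Causal n enc ∧
        errProbFB (noiselessExt (blackwellW p)) n 0 R1 R2 enc dec1 dec2 ≤ b n) →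
      errProbFB (noiselessExt (blackwellW p)) n 0 R1 R2 enc dec1 dec2 ≤ b n) := by
    intro n
    by_cases h : ∃ enc dec1 dec2, Causal n enc ∧
        errProbFB (noiselessExt (blackwellW p)) n 0 R1 R2 enc dec1 dec2 ≤ b n
    · obtain ⟨enc, dec1, dec2, h3, h4⟩ := h
      exact ⟨enc, dec1, dec2, h3, fun _ => h4⟩
    · exact ⟨fun _ _ _ => 0, fun _ => (⟨0, msgCard_pos le_rfl⟩, ⟨0, msgCard_pos hR1⟩),
        fun _ => (⟨0, msgCard_pos le_rfl⟩, ⟨0, msgCard_pos hR2⟩), fun _ _ _ _ _ => rfl,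
        fun h' => absurd h' h⟩
  choose enc dec1 dec2 hc he using this
  exact ⟨le_rfl, hR1, hR2, enc, dec1, dec2, hc, tendsto_of_tendsto_of_tendsto_of_le_of_le'
    tendsto_const_nhds hb
    (Filter.Eventually.of_forall fun n => errProbFB_noiselessExt_nonneg hp0 hp1 _ _ _)
    (hev.mono fun n hn => he n hn)⟩

/-- **Corollary (Blackwell with noiseless feedback).** Noiseless feedback enlarges the
capacity region of the noisy Blackwell DMBC, and strictly increases the sum-capacity. -/
theorem blackwell_noiselessFB_strict (p : ℝ) (hp0 : 0 < p) (hp : p < 1 / 2) :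
    CNoFB (blackwellW p) ⊂ CNoiselessFB (blackwellW p) ∧
      sSup {s : ℝ | ∃ R1 R2 : ℝ, (0, R1, R2) ∈ CNoFB (blackwellW p) ∧ s = R1 + R2}
        < sSup {s : ℝ | ∃ R1 R2 : ℝ,
            (0, R1, R2) ∈ CNoiselessFB (blackwellW p) ∧ s = R1 + R2} := by
  have hp1 : p < 1 := by linarith
  have hl2 : 0 < Real.log 2 := Real.log_pos (by norm_num)
  have hl3 : Real.log 2 < Real.log 3 := Real.log_lt_log (by norm_num) (by norm_num)
  have hl3' : 0 < Real.log 3 - 2 / 3 * Real.log 2 := by linarith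
  obtain ⟨T, hT, hT0, hTq⟩ := exists_sum_rate_bound hp0 hp
  obtain ⟨R1, R2, hmem, hlt⟩ : ∃ R1 R2 : ℝ, (0, R1, R2) ∈ CNoiselessFB (blackwellW p) ∧
      T / Real.log 2 < R1 + R2 := by
    obtain ⟨β, hβ, hβ1⟩ := exists_between
      (show T / Real.log 3 < (Real.log 2 - Real.binEntropy p) / Real.log 2 by
        rw [div_lt_iff₀ (by linarith)]
        refine hT.trans_eq ?_
        ring)
    obtain ⟨α, hα, hα1⟩ := exists_between hβ1
    have hβ0 : 0 ≤ β := (div_nonneg hT0 (by linarith)).trans hβ.le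
    refine ⟨β * (Real.log 3 - 2 / 3 * Real.log 2) / Real.log 2, β * (2 / 3),
      subset_closure (achievableFB_blackwell (α := α) hp0 hp1 (by positivity) (by positivity)
        (hβ0.trans_lt hα) ((lt_div_iff₀ hl2).1 hα1) ?_ ?_), ?_⟩
    · rw [div_mul_cancel₀ _ hl2.ne']
      exact mul_lt_mul_of_pos_right hα hl3'
    · rw [mul_assoc]
      exact mul_lt_mul_of_pos_right hα (by linarith)
    · rw [div_lt_iff₀ (by linarith)] at hβ
      rw [div_lt_iff₀ hl2, add_mul, div_mul_cancel₀ _ hl2.ne']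
      linarith
  have hNo : ∀ R1 R2 : ℝ, (0, R1, R2) ∈ CNoFB (blackwellW p) → R1 + R2 ≤ T / Real.log 2 :=
    fun _ _ h => sum_rate_le_of_mem_CNoFB hp0 hp hTq h
  refine ⟨⟨CNoFB_subset_CNoiselessFB _, fun h => hlt.not_ge (hNo _ _ (h hmem))⟩, ?_⟩
  refine (Real.sSup_le ?_ (by positivity)).trans_lt (hlt.trans_le (le_csSup ?_
    ⟨R1, R2, hmem, rfl⟩))
  · rintro s ⟨R1', R2', h, rfl⟩
    exact hNo _ _ h
  · refine ⟨2, ?_⟩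
    rintro s ⟨R1', R2', h, rfl⟩
    exact sum_rate_le_of_mem_CNoiselessFB hp0 hp1 h

end BCFB
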